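/- arXiv:1002.0979 — 7 statements merged into one kernel-verified Lean document; each statement's English description precedes it below -/
import Mathlib

section
/- Let r, σ > 0, γ = 2r/σ², a = (1+γ)/2, b = (1-γ)/2, and define f₂*(ζ) = [ζ·ln((1/γ)·√(a²+ζ²)) - b·arctan(ζ/a)]/(b²+ζ²) for ζ > 0. Then for every fixed s > 0, with ζ_τ(s) = √(2s/(τσ²) - a²), one has lim_{τ→0⁺} f₂*(ζ_τ(s)) / (√τ·(-ln τ)) = σ/(2√(2s)), and consequently lim_{τ→0⁺} sin(f₂*(ζ_τ(s))) / (√τ·(-ln τ)) = σ/(2√(2s)). -/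
open MeasureTheory Real Filter Topology Set

/-- The product `√τ · (-log τ)` vanishes as `τ → 0⁺`. -/
lemma tendsto_sqrt_mul_neg_log_nhdsGT_zero :
    Tendsto (fun τ : ℝ => √τ * (-Real.log τ)) (𝓝[>] 0) (𝓝 0) := by
  have h := (tendsto_log_mul_rpow_nhdsGT_zero (r := 1 / 2) (by norm_num)).neg
  rw [neg_zero] at h
  refine h.congr fun τ => ?_
  rw [Real.sqrt_eq_rpow]
  ring

/-- If `f / g → c` and `g → 0`, then `sin f / g → c`, provided `g` is eventually nonzero. -/
lemma tendsto_sin_div_of_tendsto_div {α : Type*} {l : Filter α} {f g : α → ℝ} {c : ℝ}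
    (hfg : Tendsto (fun x => f x / g x) l (𝓝 c)) (hg : Tendsto g l (𝓝 0))
    (hg0 : ∀ᶠ x in l, g x ≠ 0) :
    Tendsto (fun x => Real.sin (f x) / g x) l (𝓝 c) := by
  have hf : Tendsto f l (𝓝 0) := by
    have h := hfg.mul hg
    rw [mul_zero] at h
    refine h.congr' ?_
    filter_upwards [hg0] with x hx
    exact div_mul_cancel₀ _ hx
  have hsinc : Tendsto (fun x => Real.sinc (f x)) l (𝓝 1) := by
    have h := (Real.continuous_sinc.tendsto 0).comp hf
    rwa [Real.sinc_zero] at h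
  have h := hsinc.mul hfg
  rw [one_mul] at h
  refine h.congr fun x => ?_
  rcases eq_or_ne (f x) 0 with h0 | h0
  · simp [h0]
  · rw [Real.sinc_of_ne_zero h0]
    field_simp

/-- For fixed `s > 0`, with `ζ_τ(s) = √(2s/(τσ²) - a²)`, the auxiliary function `f₂*` of
Zhu's formula satisfies `lim_{τ→0⁺} f₂*(ζ_τ(s))/(√τ·(-ln τ)) = σ/(2√(2s))`, and consequently
`lim_{τ→0⁺} sin(f₂*(ζ_τ(s)))/(√τ·(-ln τ)) = σ/(2√(2s))`. -/
theorem stmt_3 (r σ : ℝ) (hr : 0 < r) (hσ : 0 < σ)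
    (γ a b : ℝ) (hγ : γ = 2 * r / σ ^ 2) (ha : a = (1 + γ) / 2) (hb : b = (1 - γ) / 2)
    (f₂ : ℝ → ℝ)
    (hf₂ : ∀ ζ : ℝ, 0 < ζ →
      f₂ ζ = (ζ * Real.log ((1 / γ) * Real.sqrt (a ^ 2 + ζ ^ 2))
        - b * Real.arctan (ζ / a)) / (b ^ 2 + ζ ^ 2))
    (s : ℝ) (hs : 0 < s) :
    Filter.Tendsto
      (fun τ : ℝ => f₂ (Real.sqrt (2 * s / (τ * σ ^ 2) - a ^ 2))
        / (Real.sqrt τ * (-Real.log τ)))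
      (nhdsWithin 0 (Set.Ioi 0)) (nhds (σ / (2 * Real.sqrt (2 * s)))) ∧
    Filter.Tendsto
      (fun τ : ℝ => Real.sin (f₂ (Real.sqrt (2 * s / (τ * σ ^ 2) - a ^ 2)))
        / (Real.sqrt τ * (-Real.log τ)))
      (nhdsWithin 0 (Set.Ioi 0)) (nhds (σ / (2 * Real.sqrt (2 * s)))) := by
  have hγ0 : 0 < γ := by rw [hγ]; positivity
  set k : ℝ := 2 * s / σ ^ 2 with hk
  have hk0 : 0 < k := by positivity
  have hkτ : ∀ τ : ℝ, 2 * s / (τ * σ ^ 2) = k / τ := fun τ => by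
    rw [hk, div_div, mul_comm τ]
  simp only [hkτ]
  have hid : Tendsto (fun τ : ℝ => τ) (𝓝[>] 0) (𝓝 0) := tendsto_nhdsWithin_of_tendsto_nhds tendsto_id
  have hpos : ∀ᶠ τ : ℝ in 𝓝[>] 0, 0 < τ := self_mem_nhdsWithin
  have hlt1 : ∀ᶠ τ : ℝ in 𝓝[>] 0, τ < 1 := hid.eventually_lt_const one_pos
  have hlin : ∀ c : ℝ, Tendsto (fun τ : ℝ => k - c * τ) (𝓝[>] 0) (𝓝 k) := fun c => by
    simpa using (hid.const_mul c).const_sub k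
  have hsqrt : Tendsto (fun τ : ℝ => √τ) (𝓝[>] 0) (𝓝 0) := by
    simpa using hid.sqrt
  have hinv : Tendsto (fun τ : ℝ => (-Real.log τ)⁻¹) (𝓝[>] 0) (𝓝 0) :=
    (tendsto_neg_atBot_atTop.comp Real.tendsto_log_nhdsGT_zero).inv_tendsto_atTop
  have harctan : Tendsto (fun τ : ℝ => √τ * Real.arctan (√(k / τ - a ^ 2) / a))
      (𝓝[>] 0) (𝓝 0) := by
    refine hsqrt.zero_mul_isBoundedUnder_le ⟨π / 2, ?_⟩
    simp only [eventually_map]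
    refine Eventually.of_forall fun τ => ?_
    exact abs_le.2 ⟨(Real.neg_pi_div_two_lt_arctan _).le, (Real.arctan_lt_pi_div_two _).le⟩
  have hmain : Tendsto
      (fun τ : ℝ => (√(k - a ^ 2 * τ) * (Real.log (√k / γ) * (-Real.log τ)⁻¹ + 1 / 2)
        - b * (√τ * Real.arctan (√(k / τ - a ^ 2) / a)) * (-Real.log τ)⁻¹) / (k - γ * τ))
      (𝓝[>] 0) (𝓝 ((√k * (Real.log (√k / γ) * 0 + 1 / 2) - b * 0 * 0) / k)) :=
    (((hlin _).sqrt.mul ((hinv.const_mul _).add_const _)).sub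
      ((harctan.const_mul b).mul hinv)).div (hlin γ) hk0.ne'
  have hlim : (√k * (Real.log (√k / γ) * 0 + 1 / 2) - b * 0 * 0) / k
      = σ / (2 * √(2 * s)) := by
    have h1 : √k = √(2 * s) / σ := by
      rw [hk, Real.sqrt_div (by positivity), Real.sqrt_sq hσ.le]
    have h2 : 0 < √(2 * s) := by positivity
    have h3 : √(2 * s) ^ 2 = 2 * s := Real.sq_sqrt (by positivity)
    rw [h1, hk]
    generalize √(2 * s) = u at *
    rw [← h3]
    field_simp
    ring
  rw [hlim] at hmain
  have hf : Tendsto (fun τ : ℝ => f₂ (√(k / τ - a ^ 2)) / (√τ * (-Real.log τ)))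
      (𝓝[>] 0) (𝓝 (σ / (2 * √(2 * s)))) := by
    refine hmain.congr' ?_
    filter_upwards [hpos, hlt1, (hlin (a ^ 2)).eventually_const_lt hk0,
      (hlin γ).eventually_const_lt hk0] with τ hτ hτ1 hτa hτγ
    have hlog : 0 < -Real.log τ := neg_pos.2 (Real.log_neg hτ hτ1)
    have hdiv : k / τ - a ^ 2 = (k - a ^ 2 * τ) / τ := by field_simp
    have hζ2 : 0 < k / τ - a ^ 2 := by rw [hdiv]; positivity
    have hζ : √(k / τ - a ^ 2) = √(k - a ^ 2 * τ) / √τ := by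
      rw [hdiv, Real.sqrt_div hτa.le]
    have hden : b ^ 2 + √(k / τ - a ^ 2) ^ 2 = (k - γ * τ) / τ := by
      rw [Real.sq_sqrt hζ2.le, ha, hb]
      field_simp
      ring
    have hln : Real.log (1 / γ * √(a ^ 2 + √(k / τ - a ^ 2) ^ 2))
        = Real.log (√k / γ) + -Real.log τ / 2 := by
      rw [Real.sq_sqrt hζ2.le, add_sub_cancel, Real.sqrt_div hk0.le,
        show 1 / γ * (√k / √τ) = √k / γ / √τ by ring,
        Real.log_div (by positivity) (by positivity), Real.log_sqrt hτ.le]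
      ring
    rw [hf₂ _ (Real.sqrt_pos.2 hζ2), hden, hln]
    generalize Real.arctan (√(k / τ - a ^ 2) / a) = θ
    rw [hζ]
    have hsτ : 0 < √τ := Real.sqrt_pos.2 hτ
    have hτsq : τ = √τ ^ 2 := (Real.sq_sqrt hτ.le).symm
    generalize -Real.log τ = L at *
    generalize √(k - a ^ 2 * τ) = z
    generalize k - γ * τ = d at *
    generalize √τ = t at *
    subst hτsq
    field_simp
  refine ⟨hf, tendsto_sin_div_of_tendsto_div hf tendsto_sqrt_mul_neg_log_nhdsGT_zero ?_⟩
  filter_upwards [hpos, hlt1] with τ hτ hτ1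
  exact (mul_pos (Real.sqrt_pos.2 hτ) (neg_pos.2 (Real.log_neg hτ hτ1))).ne'
end

section
/- Let E, r, σ > 0, γ = 2r/σ², a = (1+γ)/2, b = (1-γ)/2, and define f₁*(ζ) = [b·ln((1/γ)·√(a²+ζ²)) + ζ·arctan(ζ/a)]/(b²+ζ²) and f₂*(ζ) = [ζ·ln((1/γ)·√(a²+ζ²)) - b·arctan(ζ/a)]/(b²+ζ²) for ζ > 0. Define Zhu's boundary function ϱ^{Zhu}(τ) = γE/(1+γ) + (2E/π)·∫₀^∞ [ζ·e^{-τ(σ²/2)(a²+ζ²)}/(a²+ζ²)]·e^{-f₁*(ζ)}·sin(f₂*(ζ)) dζ for τ > 0. Then lim_{τ→0⁺} (E - ϱ^{Zhu}(τ)) / (√τ·(-ln τ)) = Eσ/√(2π); equivalently, ϱ^{Zhu}(τ) = E·(1 - (σ/√(2π))·√τ·(-ln τ)) + o(√τ·(-ln τ)) as τ → 0⁺. -/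
open MeasureTheory Real Filter Topology Set

lemma one_add_log_two_add_le {u : ℝ} (hu : 0 ≤ u) :
    Real.log (2 + u) + 1 ≤ 4 * (1 + u) ^ (1 / 2 : ℝ) := by
  rw [← Real.sqrt_eq_rpow]
  have h1 : Real.log (2 + u) = 2 * Real.log √(2 + u) := by
    rw [Real.log_sqrt (by positivity)]; ring
  have h2 := Real.log_le_sub_one_of_pos (show 0 < √(2 + u) by positivity)
  have h3 : √(2 + u) ≤ 2 * √(1 + u) := by
    rw [Real.sqrt_le_left (by positivity), mul_pow, Real.sq_sqrt (by positivity)]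
    linarith
  linarith

lemma log_two_add_div_le {u : ℝ} (hu : 0 ≤ u) :
    (Real.log (2 + u) + 1) / (1 + u) ^ 2 ≤ 4 * (1 + ‖u‖) ^ (-(3 / 2) : ℝ) := by
  rw [Real.norm_of_nonneg hu, div_le_iff₀ (by positivity), mul_assoc, ← Real.rpow_natCast,
    ← Real.rpow_add (by positivity)]
  norm_num
  have := one_add_log_two_add_le hu
  norm_num at this
  exact this

lemma integrableOn_rpow_majorant (C : ℝ) :
    IntegrableOn (fun u : ℝ => C * (1 + ‖u‖) ^ (-(3 / 2) : ℝ)) (Ioi 0) :=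
  ((integrable_one_add_norm (by norm_num)).const_mul C).integrableOn

lemma integral_one_sub_exp_neg_sq_div_sq :
    ∫ u in Ioi (0 : ℝ), (1 - Real.exp (-u ^ 2)) / u ^ 2 = √π := by
  have hcont : Continuous fun t : ℝ => Real.exp (-t ^ 2) := by fun_prop
  have hint : IntegrableOn (fun t : ℝ => Real.exp (-t ^ 2)) (Ioi 0) := by
    simpa using (integrable_exp_neg_mul_sq one_pos).integrableOn (s := Ioi 0)
  have hgauss : ∫ t in Ioi (0 : ℝ), Real.exp (-t ^ 2) = √π / 2 := by
    simpa using integral_gaussian_Ioi 1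
  have key := integral_Ioi_of_hasDerivAt_of_nonneg (a := 0) (l := √π)
    (g := fun u => 2 * (∫ t in (0 : ℝ)..u, Real.exp (-t ^ 2)) - (1 - Real.exp (-u ^ 2)) / u)
    (g' := fun u => (1 - Real.exp (-u ^ 2)) / u ^ 2) ?_ ?_ ?_ ?_
  · simpa using key
  · refine ContinuousWithinAt.sub ?_ ?_
    · exact (continuous_const.mul (intervalIntegral.continuous_primitive
        (fun _ _ => hcont.intervalIntegrable _ _) 0)).continuousWithinAt
    · rw [ContinuousWithinAt]
      simp only [div_zero]
      refine squeeze_zero' (g := fun u => u) ?_ ?_ (tendsto_id'.2 nhdsWithin_le_nhds)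
      · filter_upwards [self_mem_nhdsWithin] with u (hu : 0 ≤ u)
        exact div_nonneg (by simp [sq_nonneg]) hu
      · filter_upwards [self_mem_nhdsWithin] with u (hu : 0 ≤ u)
        refine div_le_of_le_mul₀ hu hu ?_
        nlinarith [Real.add_one_le_exp (-u ^ 2)]
  · intro u (hu : 0 < u)
    have h1 := intervalIntegral.integral_hasDerivAt_right (hcont.intervalIntegrable 0 u)
      (hcont.stronglyMeasurableAtFilter _ _) hcont.continuousAt
    have h2 : HasDerivAt (fun u : ℝ => (1 - Real.exp (-u ^ 2)) / u) _ u :=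
      (((hasDerivAt_pow 2 u).fun_neg.exp).const_sub 1).div (hasDerivAt_id u) hu.ne'
    refine ((h1.const_mul 2).sub h2).congr_deriv ?_
    simp only [Nat.cast_ofNat, Nat.add_one_sub_one, pow_one]
    field_simp
    ring
  · intro u (hu : 0 < u)
    exact div_nonneg (by simp [sq_nonneg]) (by positivity)
  · have h1 := (intervalIntegral_tendsto_integral_Ioi 0 hint tendsto_id).const_mul 2
    have h2 : Tendsto (fun u : ℝ => (1 - Real.exp (-u ^ 2)) / u) atTop (𝓝 0) := by
      refine squeeze_zero' (g := fun u => u⁻¹) ?_ ?_ tendsto_inv_atTop_zero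
      · filter_upwards [eventually_gt_atTop 0] with u hu
        exact div_nonneg (by simp [sq_nonneg]) hu.le
      · filter_upwards [eventually_gt_atTop 0] with u hu
        rw [inv_eq_one_div]
        gcongr
        linarith [Real.exp_pos (-u ^ 2)]
    rw [hgauss, mul_div_cancel₀ _ two_ne_zero] at h1
    simpa using h1.sub h2

lemma tendsto_integral_sq_div_sq {a : ℝ} (ha : 0 < a) :
    Tendsto (fun R : ℝ => ∫ y in (0 : ℝ)..R, y ^ 2 / (a ^ 2 + y ^ 2) ^ 2) atTop
      (𝓝 (π / (4 * a))) := by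
  have hpos : ∀ y : ℝ, 0 < a ^ 2 + y ^ 2 := fun y => by positivity
  have hF : ∀ R : ℝ, ∫ y in (0 : ℝ)..R, y ^ 2 / (a ^ 2 + y ^ 2) ^ 2
      = (Real.arctan (R / a) / a - R / (a ^ 2 + R ^ 2)) / 2 := by
    intro R
    rw [intervalIntegral.integral_eq_sub_of_hasDerivAt
      (f := fun y => (Real.arctan (y / a) / a - y / (a ^ 2 + y ^ 2)) / 2)]
    · simp
    · intro y _
      have h1 := (((hasDerivAt_id y).div_const a).arctan).div_const a
      have h2 := (hasDerivAt_id y).div (((hasDerivAt_pow 2 y).const_add (a ^ 2))) (hpos y).ne'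
      refine ((h1.sub h2).div_const 2).congr_deriv ?_
      have := hpos y
      have h3 : 1 + (y / a) ^ 2 = (a ^ 2 + y ^ 2) / a ^ 2 := by field_simp
      simp only [id, h3, Nat.cast_ofNat, Nat.add_one_sub_one, pow_one]
      field_simp
      ring
    · refine Continuous.intervalIntegrable ?_ _ _
      exact (continuous_pow 2).div (by fun_prop) fun y => (pow_pos (hpos y) 2).ne'
  simp_rw [hF]
  have h1 : Tendsto (fun R : ℝ => Real.arctan (R / a)) atTop (𝓝 (π / 2)) :=
    (tendsto_arctan_atTop.mono_right nhdsWithin_le_nhds).comp (tendsto_id.atTop_div_const ha)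
  have h2 : Tendsto (fun R : ℝ => R / (a ^ 2 + R ^ 2)) atTop (𝓝 0) := by
    refine squeeze_zero' (g := fun u => u⁻¹) ?_ ?_ tendsto_inv_atTop_zero
    · filter_upwards [eventually_gt_atTop 0] with u hu
      positivity
    · filter_upwards [eventually_gt_atTop 0] with u hu
      rw [inv_eq_one_div, div_le_div_iff₀ (hpos u) hu]
      nlinarith [sq_nonneg a]
  convert ((h1.div_const a).sub h2).div_const 2 using 2
  field_simp
  ring

lemma tendsto_integral_vertical_line {K : ℂ → ℂ} {a : ℝ} (ha : 0 < a)
    (hK : DifferentiableOn ℂ K {w | a ≤ w.re})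
    (hdecay : ∀ ε > 0, ∃ M : ℝ, ∀ w : ℂ, a ≤ w.re → M ≤ ‖w‖ → ‖w‖ * ‖K w‖ ≤ ε) :
    Tendsto (fun R : ℝ => ∫ y in (-R)..R, K (a + y * Complex.I)) atTop (𝓝 0) := by
  rw [Metric.tendsto_atTop]
  intro ε hε
  obtain ⟨M, hM⟩ := hdecay (ε / 5) (by positivity)
  refine ⟨max M 1, fun R hR => ?_⟩
  have hMR : M ≤ R := (le_max_left _ _).trans hR
  have hR0 : 0 < R := one_pos.trans_le ((le_max_right _ _).trans hR)
  have hbound : ∀ w : ℂ, a ≤ w.re → R ≤ ‖w‖ → ‖K w‖ ≤ ε / 5 / R := by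
    intro w hw hRw
    rw [le_div_iff₀ hR0, mul_comm]
    exact (mul_le_mul_of_nonneg_right hRw (norm_nonneg _)).trans (hM w hw (hMR.trans hRw))
  have hrect := Complex.integral_boundary_rect_eq_zero_of_differentiableOn K
    (a + (-R : ℝ) * Complex.I) ((a + R : ℝ) + R * Complex.I) (hK.mono ?_)
  · simp only [Complex.add_re, Complex.ofReal_re, Complex.mul_re, Complex.I_re, mul_zero,
      Complex.ofReal_im, Complex.I_im, mul_one, sub_self, add_zero, Complex.add_im, Complex.mul_im,
      zero_add] at hrect
    have hbot : ‖∫ x : ℝ in a..(a + R), K (x + (-R : ℝ) * Complex.I)‖ ≤ ε / 5 / R * |a + R - a| := by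
      refine intervalIntegral.norm_integral_le_of_norm_le_const fun x hx => hbound _ ?_ ?_
      · rw [uIoc_of_le (by linarith)] at hx
        simpa using hx.1.le
      · refine le_trans ?_ (Complex.abs_im_le_norm _)
        simp [abs_of_pos hR0]
    have htop : ‖∫ x : ℝ in a..(a + R), K (x + R * Complex.I)‖ ≤ ε / 5 / R * |a + R - a| := by
      refine intervalIntegral.norm_integral_le_of_norm_le_const fun x hx => hbound _ ?_ ?_
      · rw [uIoc_of_le (by linarith)] at hx
        simpa using hx.1.le
      · refine le_trans ?_ (Complex.abs_im_le_norm _)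
        simp [abs_of_pos hR0]
    have hright : ‖∫ y : ℝ in (-R)..R, K ((a + R : ℝ) + y * Complex.I)‖
        ≤ ε / 5 / R * |R - -R| := by
      refine intervalIntegral.norm_integral_le_of_norm_le_const fun y _ => hbound _ ?_ ?_
      · simpa using hR0.le
      · refine le_trans ?_ (Complex.abs_re_le_norm _)
        simp [abs_of_pos (add_pos ha hR0), ha.le]
    rw [add_sub_cancel_left, abs_of_pos hR0, div_mul_cancel₀ _ hR0.ne'] at hbot htop
    rw [sub_neg_eq_add, abs_of_pos (by positivity),
      show ε / 5 / R * (R + R) = 2 * (ε / 5) by field_simp; ring] at hright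
    rw [dist_zero_right]
    have hleft : ‖∫ y : ℝ in (-R)..R, K (a + y * Complex.I)‖
        = ‖Complex.I • ∫ y : ℝ in (-R)..R, K (a + y * Complex.I)‖ := by simp
    rw [hleft, ← sub_eq_zero.1 hrect]
    refine (norm_add_le _ _).trans_lt ?_
    have := norm_sub_le (∫ x : ℝ in a..(a + R), K (x + (-R : ℝ) * Complex.I))
      (∫ x : ℝ in a..(a + R), K (x + R * Complex.I))
    rw [norm_smul, Complex.norm_I, one_mul]
    linarith
  · intro w hw
    have := hw.1
    simp only [Complex.add_re, Complex.ofReal_re, Complex.mul_re, Complex.I_re, mul_zero,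
      Complex.ofReal_im, Complex.I_im, mul_one, sub_self, add_zero, mem_preimage] at this
    rw [uIcc_of_le (by linarith)] at this
    exact this.1

/-- The holomorphic extension of `w ↦ log (w / γ) / (w - γ)`. -/
noncomputable def logQuotient (γ : ℝ) : ℂ → ℂ := dslope (fun w => Complex.log (w / γ)) γ

lemma logQuotient_of_ne {γ : ℝ} {w : ℂ} (hγ : γ ≠ 0) (hw : w ≠ γ) :
    logQuotient γ w = Complex.log (w / γ) / (w - γ) := by
  rw [logQuotient, dslope_of_ne _ hw, slope_def_field]
  simp [div_self (Complex.ofReal_ne_zero.2 hγ)]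

lemma differentiableOn_logQuotient {γ : ℝ} (hγ : 0 < γ) :
    DifferentiableOn ℂ (logQuotient γ) {w | 0 < w.re} := by
  refine (Complex.differentiableOn_dslope ?_).2 ?_
  · exact (isOpen_lt continuous_const Complex.continuous_re).mem_nhds (by simpa using hγ)
  · intro w (hw : 0 < w.re)
    refine DifferentiableAt.differentiableWithinAt ?_
    refine DifferentiableAt.clog (by fun_prop) (Or.inl ?_)
    rw [Complex.div_ofReal_re]
    positivity

lemma tendsto_logQuotient {γ : ℝ} (hγ : 0 < γ) :
    Tendsto (logQuotient γ) (cocompact ℂ) (𝓝 0) := by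
  have hn := tendsto_norm_cocompact_atTop (E := ℂ)
  have hlim : Tendsto (fun x : ℝ => (Real.log x + |Real.log γ| + π) / (x - γ)) atTop (𝓝 0) := by
    have h1 : Tendsto (fun x : ℝ => Real.log x / x) atTop (𝓝 0) :=
      Real.isLittleO_log_id_atTop.tendsto_div_nhds_zero
    have h2 : Tendsto (fun x : ℝ => x⁻¹) atTop (𝓝 0) := tendsto_inv_atTop_zero
    have h3 : Tendsto (fun x : ℝ => (Real.log x / x + (|Real.log γ| + π) * x⁻¹) / (1 - γ * x⁻¹))
        atTop (𝓝 ((0 + (|Real.log γ| + π) * 0) / (1 - γ * 0))) :=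
      (h1.add (h2.const_mul _)).div (tendsto_const_nhds.sub (h2.const_mul γ)) (by simp)
    rw [show ((0 + (|Real.log γ| + π) * 0) / (1 - γ * 0)) = (0 : ℝ) by simp] at h3
    refine h3.congr' ?_
    filter_upwards [eventually_gt_atTop 0, eventually_gt_atTop γ] with x hx hxγ
    have : x - γ ≠ 0 := by linarith
    have h' : 1 - γ * x⁻¹ ≠ 0 := by
      rw [← div_eq_mul_inv, sub_ne_zero]
      exact ((div_lt_one hx).2 hxγ).ne'
    field_simp
    ring
  refine squeeze_zero_norm' ?_ (hlim.comp hn)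
  filter_upwards [hn.eventually_gt_atTop γ, hn.eventually_gt_atTop 1] with w hw hw1
  have hne : w ≠ γ := by
    rintro rfl
    simp [abs_of_pos hγ] at hw
  have hw0 : 0 < ‖w‖ := by linarith
  rw [logQuotient_of_ne hγ.ne' hne, norm_div, Function.comp]
  have hden : ‖w‖ - γ ≤ ‖w - γ‖ := by
    simpa [abs_of_pos hγ] using norm_sub_norm_le w (γ : ℂ)
  refine div_le_div₀ ?_ ?_ (by linarith) hden
  · have := Real.log_pos hw1
    positivity
  · refine (Complex.norm_le_abs_re_add_abs_im _).trans ?_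
    rw [Complex.log_re, Complex.log_im]
    refine add_le_add ?_ (Complex.abs_arg_le_pi _)
    rw [norm_div, Complex.norm_real, Real.norm_of_nonneg hγ.le, Real.log_div hw0.ne' hγ.ne']
    refine (abs_sub _ _).trans_eq ?_
    rw [abs_of_pos (Real.log_pos hw1)]

lemma exists_bound_of_continuous_of_tendsto_atTop {ψ : ℝ → ℝ} {l : ℝ} (hψ : Continuous ψ)
    (hlim : Tendsto ψ atTop (𝓝 l)) : ∃ C, ∀ x, 0 ≤ x → |ψ x| ≤ C := by
  obtain ⟨M, hM⟩ := eventually_atTop.1 (hlim.abs.eventually_lt_const (lt_add_one |l|))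
  obtain ⟨C, hC⟩ := (isCompact_Icc (a := 0) (b := M)).exists_bound_of_continuousOn hψ.continuousOn
  refine ⟨max C (|l| + 1), fun x hx => ?_⟩
  rcases le_total x M with h | h
  · exact (hC x ⟨hx, h⟩).trans (le_max_left _ _)
  · exact (hM x h).le.trans (le_max_right _ _)

lemma integrableOn_mul_log_div {ψ : ℝ → ℝ} {a C : ℝ} (ha : 0 < a) (hψm : Measurable ψ)
    (hψC : ∀ x, 0 ≤ x → |ψ x| ≤ C) :
    IntegrableOn (fun x => ψ x * (Real.log (2 + x) / (a ^ 2 + x ^ 2))) (Ioi 0) := by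
  refine (integrableOn_rpow_majorant (C * (2 * (1 / a ^ 2 + 1)) * 4)).mono'
    (by fun_prop) ((ae_restrict_iff' measurableSet_Ioi).2 (ae_of_all _ fun x (hx : 0 < x) => ?_))
  have hC : 0 ≤ C := (abs_nonneg _).trans (hψC x hx.le)
  have hlog : 0 < Real.log (2 + x) := Real.log_pos (by linarith)
  have h1 : Real.log (2 + x) / (a ^ 2 + x ^ 2)
      ≤ 2 * (1 / a ^ 2 + 1) * ((Real.log (2 + x) + 1) / (1 + x) ^ 2) := by
    have h2 : (1 + x) ^ 2 ≤ 2 * (1 / a ^ 2 + 1) * (a ^ 2 + x ^ 2) := by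
      have : 2 * (1 / a ^ 2 + 1) * (a ^ 2 + x ^ 2) = 2 + 2 * x ^ 2 + 2 * a ^ 2 + 2 * x ^ 2 / a ^ 2 := by
        field_simp
        ring
      rw [this]
      have : 0 ≤ 2 * x ^ 2 / a ^ 2 := by positivity
      nlinarith [sq_nonneg (x - 1), sq_nonneg a]
    rw [← mul_div_assoc, div_le_div_iff₀ (by positivity) (by positivity)]
    calc Real.log (2 + x) * (1 + x) ^ 2
        ≤ (Real.log (2 + x) + 1) * (2 * (1 / a ^ 2 + 1) * (a ^ 2 + x ^ 2)) := by
          gcongr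
          linarith
      _ = _ := by ring
  rw [Real.norm_eq_abs, abs_mul, abs_of_pos (div_pos hlog (by positivity : 0 < a ^ 2 + x ^ 2))]
  calc |ψ x| * (Real.log (2 + x) / (a ^ 2 + x ^ 2))
      ≤ C * (2 * (1 / a ^ 2 + 1) * (4 * (1 + ‖x‖) ^ (-(3 / 2) : ℝ))) := by
        gcongr
        · exact hψC x hx.le
        · exact h1.trans (by gcongr; exact log_two_add_div_le hx.le)
    _ = _ := by ring

lemma one_sub_exp_neg_div_le {u x : ℝ} (hu : 0 < u) (hx : u ^ 2 ≤ x) :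
    (1 - Real.exp (-x)) / x ≤ 4 / (1 + u) ^ 2 := by
  have hx0 : 0 < x := (pow_pos hu 2).trans_le hx
  have h1 : 1 - Real.exp (-x) ≤ x := by linarith [Real.add_one_le_exp (-x)]
  have h2 := Real.exp_pos (-x)
  have h3 : Real.exp (-x) ≤ 1 := Real.exp_le_one_iff.2 (by linarith)
  rw [div_le_div_iff₀ hx0 (by positivity)]
  rcases le_total u 1 with h | h
  · nlinarith [mul_le_mul h1 (show (1 + u) ^ 2 ≤ 4 by nlinarith) (by positivity) hx0.le]
  · nlinarith [mul_le_mul (show 1 - Real.exp (-x) ≤ 1 by linarith)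
      (show (1 + u) ^ 2 ≤ 4 * u ^ 2 by nlinarith) (by positivity) zero_le_one]

lemma tendsto_log_two_add_inv_mul_div {u : ℝ} (hu : 0 < u) :
    Tendsto (fun t : ℝ => Real.log (2 + t⁻¹ * u) / (-Real.log t)) (𝓝[>] 0) (𝓝 1) := by
  have hneg : Tendsto (fun t : ℝ => -Real.log t) (𝓝[>] 0) atTop :=
    tendsto_neg_atBot_atTop.comp tendsto_log_nhdsGT_zero
  have hnum : Tendsto (fun t : ℝ => Real.log (2 * t + u)) (𝓝[>] 0) (𝓝 (Real.log u)) := by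
    have : ContinuousAt (fun t : ℝ => Real.log (2 * t + u)) 0 :=
      ContinuousAt.log (by fun_prop) (by simpa using hu.ne')
    simpa using this.tendsto.mono_left nhdsWithin_le_nhds
  have := (hnum.div_atTop hneg).add_const 1
  rw [zero_add] at this
  refine this.congr' ?_
  filter_upwards [self_mem_nhdsWithin, hneg.eventually_gt_atTop 0] with t (ht : 0 < t) hlt
  have : 2 + t⁻¹ * u = (2 * t + u) / t := by field_simp
  have hlt' : Real.log t ≠ 0 := by linarith
  rw [this, Real.log_div (by positivity) ht.ne']
  field_simp
  ring

lemma tendsto_integral_one_sub_exp_div {ψ : ℝ → ℝ} {a C : ℝ} (ha : 0 < a) (hψm : Measurable ψ)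
    (hψC : ∀ x, 0 ≤ x → |ψ x| ≤ C) (hψ : Tendsto ψ atTop (𝓝 1)) :
    Tendsto (fun t : ℝ => (∫ x in Ioi (0 : ℝ), ψ x * (Real.log (2 + x) / (a ^ 2 + x ^ 2))
      * (1 - Real.exp (-(t ^ 2 * (a ^ 2 + x ^ 2))))) / (t * -Real.log t))
      (𝓝[>] 0) (𝓝 √π) := by
  have hneg : Tendsto (fun t : ℝ => -Real.log t) (𝓝[>] 0) atTop :=
    tendsto_neg_atBot_atTop.comp tendsto_log_nhdsGT_zero
  set F : ℝ → ℝ → ℝ := fun t u => ψ (t⁻¹ * u) * (Real.log (2 + t⁻¹ * u) / (-Real.log t))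
    * ((1 - Real.exp (-(t ^ 2 * a ^ 2 + u ^ 2))) / (t ^ 2 * a ^ 2 + u ^ 2)) with hF
  have hscale : ∀ᶠ t in 𝓝[>] (0 : ℝ), ∫ u in Ioi (0 : ℝ), F t u =
      (∫ x in Ioi (0 : ℝ), ψ x * (Real.log (2 + x) / (a ^ 2 + x ^ 2))
        * (1 - Real.exp (-(t ^ 2 * (a ^ 2 + x ^ 2))))) / (t * -Real.log t) := by
    filter_upwards [self_mem_nhdsWithin, hneg.eventually_gt_atTop 0] with t (ht : 0 < t) hlt
    have := integral_comp_mul_left_Ioi (fun x => ψ x * (Real.log (2 + x) / (a ^ 2 + x ^ 2))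
        * (1 - Real.exp (-(t ^ 2 * (a ^ 2 + x ^ 2))))) 0 (inv_pos.2 ht)
    rw [mul_zero, inv_inv, smul_eq_mul] at this
    rw [eq_div_iff (by positivity), ← mul_right_inj' ht.ne', ← this, mul_comm (integral _ _),
      ← mul_assoc, ← integral_const_mul]
    refine integral_congr_ae (ae_of_all _ fun u => ?_)
    have h1 : t ^ 2 * (a ^ 2 + (t⁻¹ * u) ^ 2) = t ^ 2 * a ^ 2 + u ^ 2 := by field_simp
    have h2 : a ^ 2 + (t⁻¹ * u) ^ 2 = (t ^ 2 * a ^ 2 + u ^ 2) / t ^ 2 := by field_simp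
    simp only [hF, h1]
    rw [h2]
    have h3 : 0 < t ^ 2 * a ^ 2 + u ^ 2 := by positivity
    have h4 : Real.log t ≠ 0 := by linarith
    field_simp
  refine Tendsto.congr' hscale ?_
  rw [← integral_one_sub_exp_neg_sq_div_sq]
  refine tendsto_integral_filter_of_dominated_convergence
    (fun u => C * 4 * 4 * (1 + ‖u‖) ^ (-(3 / 2) : ℝ)) (Eventually.of_forall fun t => ?_) ?_
    (integrableOn_rpow_majorant _)
    ((ae_restrict_iff' measurableSet_Ioi).2 (ae_of_all _ fun u (hu : 0 < u) => ?_))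
  · simp only [hF]
    fun_prop
  · filter_upwards [self_mem_nhdsWithin, hneg.eventually_ge_atTop 1] with t (ht : 0 < t) hlt
    refine (ae_restrict_iff' measurableSet_Ioi).2 (ae_of_all _ fun u (hu : 0 < u) => ?_)
    have htu : 0 ≤ t⁻¹ * u := by positivity
    have hC : 0 ≤ C := (abs_nonneg _).trans (hψC _ htu)
    have hlog : 0 < Real.log (2 + t⁻¹ * u) := Real.log_pos (by linarith)
    have hlog2 : 0 < Real.log (2 + u) := Real.log_pos (by linarith)
    have hlog' : Real.log (2 + t⁻¹ * u) / (-Real.log t) ≤ Real.log (2 + u) + 1 := by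
      rw [div_le_iff₀ (by linarith)]
      have ht1 : t ≤ 1 := by
        by_contra! h
        linarith [Real.log_pos h]
      have : Real.log (2 + t⁻¹ * u) ≤ Real.log ((2 + u) / t) := by
        refine Real.log_le_log (by linarith) ?_
        rw [le_div_iff₀ ht]
        field_simp
        linarith
      rw [Real.log_div (by linarith) ht.ne'] at this
      nlinarith
    have hquot := one_sub_exp_neg_div_le hu (le_add_of_nonneg_left (by positivity) :
      u ^ 2 ≤ t ^ 2 * a ^ 2 + u ^ 2)
    have hquot0 : 0 ≤ (1 - Real.exp (-(t ^ 2 * a ^ 2 + u ^ 2))) / (t ^ 2 * a ^ 2 + u ^ 2) :=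
      div_nonneg (sub_nonneg.2 (Real.exp_le_one_iff.2 (by nlinarith [sq_nonneg (t * a)])))
        (by positivity)
    have hL0 : 0 ≤ Real.log (2 + t⁻¹ * u) / (-Real.log t) := div_nonneg hlog.le (by linarith)
    rw [Real.norm_eq_abs, abs_mul, abs_mul, abs_of_nonneg hquot0, abs_of_nonneg hL0]
    calc _ ≤ C * (Real.log (2 + u) + 1) * (4 / (1 + u) ^ 2) := by
          gcongr
          exact hψC _ htu
      _ = C * 4 * ((Real.log (2 + u) + 1) / (1 + u) ^ 2) := by ring
      _ ≤ C * 4 * (4 * (1 + ‖u‖) ^ (-(3 / 2) : ℝ)) := by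
          gcongr
          exact log_two_add_div_le hu.le
      _ = _ := by ring
  · have h1 : Tendsto (fun t : ℝ => ψ (t⁻¹ * u)) (𝓝[>] 0) (𝓝 1) :=
      hψ.comp (tendsto_inv_nhdsGT_zero.atTop_mul_const hu)
    have h2 : Tendsto (fun t : ℝ => (1 - Real.exp (-(t ^ 2 * a ^ 2 + u ^ 2)))
        / (t ^ 2 * a ^ 2 + u ^ 2)) (𝓝[>] 0) (𝓝 ((1 - Real.exp (-u ^ 2)) / u ^ 2)) := by
      have : ContinuousAt (fun t : ℝ => (1 - Real.exp (-(t ^ 2 * a ^ 2 + u ^ 2)))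
          / (t ^ 2 * a ^ 2 + u ^ 2)) 0 :=
        ContinuousAt.div (by fun_prop) (by fun_prop) (by simpa using hu.ne')
      simpa using this.tendsto.mono_left nhdsWithin_le_nhds
    have h3 := (h1.mul (tendsto_log_two_add_inv_mul_div hu)).mul h2
    rwa [one_mul, one_mul] at h3

lemma log_vertical_div {γ a : ℝ} (hγ : 0 < γ) (ha : 0 < a) (y : ℝ) :
    Complex.log ((a + y * Complex.I) / γ)
      = Real.log (1 / γ * √(a ^ 2 + y ^ 2)) + Real.arctan (y / a) * Complex.I := by
  have hre : ((a + y * Complex.I : ℂ) / γ).re = a / γ := by simp [Complex.div_ofReal_re]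
  have him : ((a + y * Complex.I : ℂ) / γ).im = y / γ := by simp [Complex.div_ofReal_im]
  apply Complex.ext
  · rw [Complex.log_re, norm_div, Complex.norm_add_mul_I, Complex.norm_real,
      Real.norm_of_nonneg hγ.le, div_eq_mul_one_div, mul_comm]
    generalize Real.arctan (y / a) = θ
    simp
  · have harg : |Complex.arg ((a + y * Complex.I) / γ)| < π / 2 :=
      Complex.abs_arg_lt_pi_div_two_iff.2 (Or.inl (by rw [hre]; positivity))
    rw [Complex.log_im, ← Real.arctan_tan (abs_lt.1 harg).1 (abs_lt.1 harg).2, Complex.tan_arg,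
      hre, him, div_div_div_cancel_right₀ hγ.ne']
    generalize Real.arctan (y / a) = θ
    simp

lemma logQuotient_vertical {γ a b y : ℝ} (hγ : 0 < γ) (ha : 0 < a) (hb : b = a - γ)
    (hy : y ≠ 0) :
    logQuotient γ (a + y * Complex.I)
      = ((b * Real.log (1 / γ * √(a ^ 2 + y ^ 2)) + y * Real.arctan (y / a)) / (b ^ 2 + y ^ 2) : ℝ)
        - ((y * Real.log (1 / γ * √(a ^ 2 + y ^ 2)) - b * Real.arctan (y / a))
            / (b ^ 2 + y ^ 2) : ℝ) * Complex.I := by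
  have hne : (a + y * Complex.I : ℂ) ≠ γ := fun h => hy (by simpa using congrArg Complex.im h)
  have hb' : (b : ℂ) + y * Complex.I ≠ 0 := fun h => hy (by simpa using congrArg Complex.im h)
  have hden : (b ^ 2 + y ^ 2 : ℂ) ≠ 0 := by
    have : 0 < b ^ 2 + y ^ 2 := by positivity
    exact_mod_cast this.ne'
  have hsub : (a + y * Complex.I : ℂ) - γ = b + y * Complex.I := by
    rw [hb]; push_cast; ring
  rw [logQuotient_of_ne hγ.ne' hne, log_vertical_div hγ ha, hsub, div_eq_iff hb']
  generalize Real.log (1 / γ * √(a ^ 2 + y ^ 2)) = L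
  generalize Real.arctan (y / a) = θ
  push_cast
  field_simp
  linear_combination (y ^ 2 * L - b * θ * y : ℂ) * Complex.I_sq

lemma exp_neg_logQuotient_vertical_im {γ a b y : ℝ} (hγ : 0 < γ) (ha : 0 < a) (hb : b = a - γ)
    (hy : y ≠ 0) :
    (Complex.exp (-logQuotient γ (a + y * Complex.I))).im
      = Real.exp (-((b * Real.log (1 / γ * √(a ^ 2 + y ^ 2)) + y * Real.arctan (y / a))
          / (b ^ 2 + y ^ 2)))
        * Real.sin ((y * Real.log (1 / γ * √(a ^ 2 + y ^ 2)) - b * Real.arctan (y / a))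
            / (b ^ 2 + y ^ 2)) := by
  rw [logQuotient_vertical hγ ha hb hy, Complex.exp_im]
  simp only [Complex.neg_re, Complex.neg_im, Complex.sub_re, Complex.sub_im, Complex.re_ofReal_mul,
    Complex.im_ofReal_mul, Complex.ofReal_re, Complex.ofReal_im, Complex.I_re, Complex.I_im]
  ring_nf

lemma continuous_exp_neg_logQuotient_vertical {γ a : ℝ} (hγ : 0 < γ) (ha : 0 < a) :
    Continuous fun y : ℝ => (Complex.exp (-logQuotient γ (a + y * Complex.I))).im := by
  refine Complex.continuous_im.comp (Complex.continuous_exp.comp (Continuous.neg ?_))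
  exact (differentiableOn_logQuotient hγ).continuousOn.comp_continuous (by fun_prop)
    fun y => by simpa using ha

/-- The function `w ↦ exp (-logQuotient γ w) - 1 + 1 / w`, which vanishes at `1 + γ`. -/
noncomputable def expLogRemainder (γ : ℝ) (w : ℂ) : ℂ :=
  Complex.exp (-logQuotient γ w) - 1 + w⁻¹

lemma expLogRemainder_one_add {γ : ℝ} (hγ : 0 < γ) : expLogRemainder γ (1 + γ) = 0 := by
  have hγ' : (γ : ℂ) ≠ 0 := Complex.ofReal_ne_zero.2 hγ.ne'
  have h1 : (1 + γ : ℂ) ≠ 0 := by exact_mod_cast (by positivity : 1 + γ ≠ 0)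
  rw [expLogRemainder, logQuotient_of_ne hγ.ne' (by simp), add_sub_cancel_right, div_one,
    Complex.exp_neg, Complex.exp_log (div_ne_zero h1 hγ')]
  field_simp
  ring

lemma differentiableOn_expLogRemainder {γ : ℝ} (hγ : 0 < γ) :
    DifferentiableOn ℂ (expLogRemainder γ) {w | 0 < w.re} := by
  refine ((differentiableOn_logQuotient hγ).neg.cexp.sub_const 1).add
    (differentiableOn_id.inv ?_)
  rintro w (hw : 0 < w.re) rfl
  simp at hw

lemma tendsto_expLogRemainder {γ : ℝ} (hγ : 0 < γ) :
    Tendsto (expLogRemainder γ) (cocompact ℂ) (𝓝 0) := by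
  have hinv : Tendsto (fun w : ℂ => w⁻¹) (cocompact ℂ) (𝓝 0) := by
    rw [← Metric.cobounded_eq_cocompact]
    exact tendsto_inv₀_cobounded
  have := (((Complex.continuous_exp.tendsto _).comp (tendsto_logQuotient hγ).neg).sub_const 1).add
    hinv
  rw [neg_zero, Complex.exp_zero, sub_self, zero_add] at this
  exact this

/-- The holomorphic function whose real part on the line `re w = (1 + γ) / 2` is the integrand of
Zhu's formula at expiry, up to an elementary term. -/
noncomputable def contourIntegrand (γ a : ℝ) (w : ℂ) : ℂ :=
  (w - a) / w * dslope (expLogRemainder γ) (1 + γ) w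

lemma contourIntegrand_of_ne {γ a : ℝ} {w : ℂ} (hγ : 0 < γ) (ha : 1 + γ = 2 * a)
    (hw : w ≠ 1 + γ) :
    contourIntegrand γ a w = (w - a) / w * (expLogRemainder γ w / (w - 2 * a)) := by
  have ha' : (1 + γ : ℂ) = 2 * a := by exact_mod_cast ha
  rw [contourIntegrand, dslope_of_ne _ hw, slope_def_field, expLogRemainder_one_add hγ, sub_zero,
    ha']

lemma differentiableOn_contourIntegrand {γ : ℝ} (hγ : 0 < γ) (a : ℝ) :
    DifferentiableOn ℂ (contourIntegrand γ a) {w | 0 < w.re} := by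
  refine ((differentiableOn_id.sub_const _).div differentiableOn_id ?_).mul
    ((Complex.differentiableOn_dslope ?_).2 (differentiableOn_expLogRemainder hγ))
  · rintro w (hw : 0 < w.re) h
    rw [show w = 0 from h] at hw
    simp at hw
  · exact (isOpen_lt continuous_const Complex.continuous_re).mem_nhds (by simp; positivity)

lemma contourIntegrand_decay {γ a : ℝ} (hγ : 0 < γ) (ha : 1 + γ = 2 * a) {ε : ℝ} (hε : 0 < ε) :
    ∃ M : ℝ, ∀ w : ℂ, M ≤ ‖w‖ → ‖w‖ * ‖contourIntegrand γ a w‖ ≤ ε := by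
  have ha0 : 0 < a := by linarith
  have hlim := tendsto_expLogRemainder hγ
  rw [← Metric.cobounded_eq_cocompact, ← comap_norm_atTop] at hlim
  obtain ⟨t, ht, hsub⟩ := hlim.norm.eventually_lt_const (show ‖(0 : ℂ)‖ < ε / 2 by simpa using hε)
  obtain ⟨M, hM⟩ := mem_atTop_sets.1 ht
  refine ⟨max M (5 * a), fun w hw => ?_⟩
  have hwa : 5 * a ≤ ‖w‖ := (le_max_right _ _).trans hw
  have hw0 : 0 < ‖w‖ := by linarith
  have hrem : ‖expLogRemainder γ w‖ < ε / 2 := hsub (hM _ ((le_max_left _ _).trans hw))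
  have hnum : ‖w - a‖ ≤ ‖w‖ + a := by
    simpa [abs_of_pos ha0] using norm_sub_le w (a : ℂ)
  have hden : ‖w‖ - 2 * a ≤ ‖w - 2 * a‖ := by
    simpa [abs_of_pos ha0] using norm_sub_norm_le w (2 * a : ℂ)
  have hden0 : 0 < ‖w - 2 * a‖ := by linarith
  have hne : w ≠ 1 + γ := by
    rw [show (1 + γ : ℂ) = 2 * a by exact_mod_cast ha]
    exact sub_ne_zero.1 (norm_pos_iff.1 hden0)
  rw [contourIntegrand_of_ne hγ ha hne, norm_mul, norm_div, norm_div, ← mul_assoc,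
    mul_div_cancel₀ _ hw0.ne', ← mul_div_assoc, div_le_iff₀ hden0]
  nlinarith [mul_le_mul (show ‖w - a‖ ≤ 2 * ‖w - 2 * a‖ by linarith) hrem.le (norm_nonneg _)
    (by positivity)]

lemma contourIntegrand_vertical_re {γ a : ℝ} (hγ : 0 < γ) (ha : 1 + γ = 2 * a) (y : ℝ) :
    (contourIntegrand γ a (a + y * Complex.I)).re
      = y / (a ^ 2 + y ^ 2) * (Complex.exp (-logQuotient γ (a + y * Complex.I))).im
        - y ^ 2 / (a ^ 2 + y ^ 2) ^ 2 := by
  have ha0 : 0 < a := by linarith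
  have ha' : (1 + γ : ℂ) = 2 * a := by exact_mod_cast ha
  have hpos : (a ^ 2 + y ^ 2 : ℂ) ≠ 0 := by exact_mod_cast (by positivity : a ^ 2 + y ^ 2 ≠ 0)
  have hne : (a + y * Complex.I : ℂ) ≠ 1 + γ := by
    rw [ha']
    intro h
    have := congrArg Complex.re h
    simp at this
    linarith
  have key : contourIntegrand γ a (a + y * Complex.I)
      = ((y / (a ^ 2 + y ^ 2) : ℝ) : ℂ)
        * (-Complex.I * expLogRemainder γ (a + y * Complex.I)) := by
    rw [contourIntegrand_of_ne hγ ha hne]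
    generalize expLogRemainder γ (a + y * Complex.I) = P
    push_cast
    have h3 : (a + y * Complex.I : ℂ) * (a + y * Complex.I - 2 * a) = -(a ^ 2 + y ^ 2) := by
      linear_combination (y ^ 2 : ℂ) * Complex.I_sq
    rw [div_mul_div_comm, h3]
    field_simp
    ring
  rw [key, Complex.re_ofReal_mul, expLogRemainder]
  have hinv : ((a + y * Complex.I : ℂ)⁻¹).im = -(y / (a ^ 2 + y ^ 2)) := by
    rw [Complex.inv_im, Complex.normSq_add_mul_I]
    simp [neg_div]
  have : (-Complex.I * (Complex.exp (-logQuotient γ (a + y * Complex.I)) - 1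
      + (a + y * Complex.I)⁻¹)).re
      = (Complex.exp (-logQuotient γ (a + y * Complex.I))).im - y / (a ^ 2 + y ^ 2) := by
    simp only [Complex.neg_re, Complex.mul_re, neg_mul, Complex.I_re, Complex.I_im, Complex.add_im,
      Complex.sub_im, Complex.one_im, hinv]
    ring
  rw [this, mul_sub, div_mul_div_comm, ← sq, ← sq]

lemma tendsto_integral_zhu {γ a b : ℝ} (hγ : 0 < γ) (ha : 1 + γ = 2 * a) (hb : b = a - γ) :
    Tendsto (fun R : ℝ => ∫ y in (0 : ℝ)..R,
      y / (a ^ 2 + y ^ 2) * (Complex.exp (-logQuotient γ (a + y * Complex.I))).im) atTop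
      (𝓝 (π / (4 * a))) := by
  have ha0 : 0 < a := by linarith
  set q : ℝ → ℝ := fun y => (contourIntegrand γ a (a + y * Complex.I)).re with hq
  have hcK : Continuous fun y : ℝ => contourIntegrand γ a (a + y * Complex.I) :=
    (differentiableOn_contourIntegrand hγ a).continuousOn.comp_continuous (by fun_prop)
      fun y => by simpa using ha0
  have hcq : Continuous q := Complex.continuous_re.comp hcK
  have heven : ∀ y, q (-y) = q y := by
    intro y
    simp only [hq, contourIntegrand_vertical_re hγ ha]
    rcases eq_or_ne y 0 with rfl | hy
    · simp
    · rw [exp_neg_logQuotient_vertical_im hγ ha0 hb hy,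
        exp_neg_logQuotient_vertical_im hγ ha0 hb (neg_ne_zero.2 hy)]
      have h1 : (-y * Real.log (1 / γ * √(a ^ 2 + y ^ 2)) - b * -Real.arctan (y / a))
          / (b ^ 2 + y ^ 2) = -((y * Real.log (1 / γ * √(a ^ 2 + y ^ 2))
            - b * Real.arctan (y / a)) / (b ^ 2 + y ^ 2)) := by ring
      rw [neg_sq, neg_div a y, Real.arctan_neg, neg_mul_neg, h1, Real.sin_neg]
      ring
  have hsymm : ∀ R : ℝ, ∫ y in (-R)..R, q y = 2 * ∫ y in (0 : ℝ)..R, q y := by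
    intro R
    rw [← intervalIntegral.integral_add_adjacent_intervals (b := 0)
      (hcq.intervalIntegrable _ _) (hcq.intervalIntegrable _ _)]
    have := intervalIntegral.integral_comp_neg (a := 0) (b := R) q
    simp only [heven, neg_zero] at this
    rw [← this]
    ring
  have hlim := tendsto_integral_vertical_line ha0
    ((differentiableOn_contourIntegrand hγ a).mono fun w (hw : a ≤ w.re) => ha0.trans_le hw)
    (fun ε hε => (contourIntegrand_decay hγ ha hε).imp fun M hM w _ => hM w)
  have hre := (Complex.continuous_re.tendsto _).comp hlim
  have hhalf : Tendsto (fun R : ℝ => ∫ y in (0 : ℝ)..R, q y) atTop (𝓝 0) := by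
    have h : ∀ R : ℝ, (∫ y in (-R)..R, contourIntegrand γ a (a + y * Complex.I)).re
        = 2 * ∫ y in (0 : ℝ)..R, q y := by
      intro R
      rw [← hsymm]
      exact (intervalIntegral.intervalIntegral_re (hcK.intervalIntegrable _ _)).symm
    have := hre.div_const 2
    simp only [Function.comp_def, h, Complex.zero_re, zero_div] at this
    simpa using this
  have hsum := hhalf.add (tendsto_integral_sq_div_sq ha0)
  rw [zero_add] at hsum
  refine hsum.congr fun R => ?_
  have hpos : ∀ y : ℝ, 0 < a ^ 2 + y ^ 2 := fun y => by positivity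
  rw [← intervalIntegral.integral_add (hcq.intervalIntegrable _ _)]
  · refine intervalIntegral.integral_congr fun y _ => ?_
    simp only [hq, contourIntegrand_vertical_re hγ ha]
    ring
  · exact Continuous.intervalIntegrable ((continuous_pow 2).div (by fun_prop)
      fun y => (pow_pos (hpos y) 2).ne') _ _

lemma tendsto_log_sqrt_div_log {γ : ℝ} (hγ : 0 < γ) (a : ℝ) :
    Tendsto (fun y : ℝ => Real.log (1 / γ * √(a ^ 2 + y ^ 2)) / Real.log (2 + y)) atTop (𝓝 1) := by
  have hlog : Tendsto (fun y : ℝ => Real.log (2 + y)) atTop atTop :=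
    tendsto_log_atTop.comp (tendsto_atTop_add_const_left _ _ tendsto_id)
  have h1 : Tendsto (fun y : ℝ => Real.log (1 / γ * (√(a ^ 2 * y⁻¹ ^ 2 + 1) / (2 * y⁻¹ + 1)))) atTop
      (𝓝 (Real.log (1 / γ))) := by
    have : ContinuousAt (fun x : ℝ => Real.log (1 / γ * (√(a ^ 2 * x ^ 2 + 1) / (2 * x + 1)))) 0 :=
      ContinuousAt.log (continuousAt_const.mul (ContinuousAt.div (by fun_prop) (by fun_prop)
        (by simp))) (by simpa using hγ.ne')
    have h := this.tendsto.comp tendsto_inv_atTop_zero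
    simpa [Function.comp_def] using h
  have h2 := (h1.div_atTop hlog).add_const 1
  rw [zero_add] at h2
  refine h2.congr' ?_
  filter_upwards [eventually_gt_atTop 0] with y hy
  have hlogy : 0 < Real.log (2 + y) := Real.log_pos (by linarith)
  have hsqrt : √(a ^ 2 + y ^ 2) = y * √(a ^ 2 * y⁻¹ ^ 2 + 1) := by
    rw [← Real.sqrt_sq hy.le, ← Real.sqrt_mul (sq_nonneg y), Real.sqrt_sq hy.le]
    congr 1
    field_simp
  have harg : 1 / γ * (√(a ^ 2 * y⁻¹ ^ 2 + 1) / (2 * y⁻¹ + 1))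
      = 1 / γ * √(a ^ 2 + y ^ 2) / (2 + y) := by
    rw [hsqrt]
    field_simp
  have hpos : 0 < √(a ^ 2 + y ^ 2) := Real.sqrt_pos.2 (by positivity)
  rw [harg, Real.log_div (by positivity) (by positivity)]
  field_simp
  ring

lemma tendsto_mul_phase_div_log {γ : ℝ} (hγ : 0 < γ) {a : ℝ} (ha : 0 < a) (b : ℝ) :
    Tendsto (fun y : ℝ => y * ((y * Real.log (1 / γ * √(a ^ 2 + y ^ 2)) - b * Real.arctan (y / a))
      / (b ^ 2 + y ^ 2)) / Real.log (2 + y)) atTop (𝓝 1) := by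
  have hlog : Tendsto (fun y : ℝ => Real.log (2 + y)) atTop atTop :=
    tendsto_log_atTop.comp (tendsto_atTop_add_const_left _ _ tendsto_id)
  have h1 : Tendsto (fun y : ℝ => 1 / (b ^ 2 * y⁻¹ ^ 2 + 1)) atTop (𝓝 1) := by
    have : ContinuousAt (fun x : ℝ => 1 / (b ^ 2 * x ^ 2 + 1)) 0 :=
      ContinuousAt.div (by fun_prop) (by fun_prop) (by simp)
    have h := this.tendsto.comp tendsto_inv_atTop_zero
    simpa [Function.comp_def] using h
  have h2 : Tendsto (fun y : ℝ => Real.arctan (y / a)) atTop (𝓝 (π / 2)) :=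
    (tendsto_arctan_atTop.mono_right nhdsWithin_le_nhds).comp (tendsto_id.atTop_div_const ha)
  have h3 := (h1.mul (tendsto_log_sqrt_div_log hγ a)).sub
    ((((h2.const_mul b).mul h1).mul tendsto_inv_atTop_zero).div_atTop hlog)
  rw [mul_one, sub_zero] at h3
  refine h3.congr' ?_
  filter_upwards [eventually_gt_atTop 0] with y hy
  have hlogy : 0 < Real.log (2 + y) := Real.log_pos (by linarith)
  have hden : 1 / (b ^ 2 * y⁻¹ ^ 2 + 1) = y ^ 2 / (b ^ 2 + y ^ 2) := by field_simp
  rw [hden]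
  field_simp

lemma tendsto_mul_im_div_log {γ a b : ℝ} (hγ : 0 < γ) (ha : 0 < a) (hb : b = a - γ) :
    Tendsto (fun y : ℝ => y * (Complex.exp (-logQuotient γ (a + y * Complex.I))).im
      / Real.log (2 + |y|)) atTop (𝓝 1) := by
  have hline : Tendsto (fun y : ℝ => (a + y * Complex.I : ℂ)) atTop (cocompact ℂ) := by
    rw [← Metric.cobounded_eq_cocompact, ← tendsto_norm_atTop_iff_cobounded]
    refine tendsto_atTop_mono (fun y => ?_) tendsto_id
    have him : (a + y * Complex.I : ℂ).im = y := by simp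
    calc y ≤ |(a + y * Complex.I : ℂ).im| := him.symm ▸ le_abs_self y
      _ ≤ _ := Complex.abs_im_le_norm _
  have hh := (tendsto_logQuotient hγ).comp hline
  have hre := (Complex.continuous_re.tendsto _).comp hh
  have him := ((Complex.continuous_im.tendsto _).comp hh).neg
  have hexp := (Real.continuous_exp.tendsto _).comp hre.neg
  have hsinc := (Real.continuous_sinc.tendsto _).comp him
  have hlim := (hexp.mul hsinc).mul (tendsto_mul_phase_div_log hγ ha b)
  simp only [Complex.zero_re, Complex.zero_im, neg_zero, Real.exp_zero, Real.sinc_zero,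
    mul_one] at hlim
  refine hlim.congr' ?_
  filter_upwards [eventually_gt_atTop 0] with y hy
  have hsin : ∀ x : ℝ, Real.sin x = Real.sinc x * x := by
    intro x
    rcases eq_or_ne x 0 with rfl | hx
    · simp
    · rw [Real.sinc_of_ne_zero hx, div_mul_cancel₀ _ hx]
  simp only [Function.comp_apply]
  rw [exp_neg_logQuotient_vertical_im hγ ha hb hy.ne', logQuotient_vertical hγ ha hb hy.ne',
    abs_of_pos hy, hsin]
  simp only [Complex.sub_re, Complex.sub_im, Complex.re_ofReal_mul,
    Complex.im_ofReal_mul, Complex.ofReal_re, Complex.ofReal_im, Complex.I_re, Complex.I_im,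
    mul_zero, sub_zero, mul_one, zero_sub, neg_neg]
  ring

lemma tendsto_mul_neg_log_div {c : ℝ} (hc : 0 < c) :
    Tendsto (fun τ : ℝ => c * √τ * -Real.log (c * √τ) / (√τ * -Real.log τ)) (𝓝[>] 0)
      (𝓝 (c / 2)) := by
  have hneg : Tendsto (fun t : ℝ => -Real.log t) (𝓝[>] 0) atTop :=
    tendsto_neg_atBot_atTop.comp tendsto_log_nhdsGT_zero
  have h := ((tendsto_const_nhds (x := -(c * Real.log c))).div_atTop hneg).add_const (c / 2)
  rw [zero_add] at h
  refine h.congr' ?_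
  filter_upwards [self_mem_nhdsWithin, hneg.eventually_gt_atTop 0] with τ (hτ : 0 < τ) hlt
  have hs : 0 < √τ := Real.sqrt_pos.2 hτ
  have hl : Real.log τ ≠ 0 := by linarith
  rw [Real.log_mul hc.ne' hs.ne', Real.log_sqrt hτ.le]
  field_simp

/-- Asymptotics of Zhu's early exercise boundary formula close to expiry:
`lim_{τ→0⁺} (E - ϱ^{Zhu}(τ))/(√τ·(-ln τ)) = Eσ/√(2π)`. -/
theorem stmt_4 (E r σ : ℝ) (hE : 0 < E) (hr : 0 < r) (hσ : 0 < σ)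
    (γ a b : ℝ) (hγ : γ = 2 * r / σ ^ 2) (ha : a = (1 + γ) / 2) (hb : b = (1 - γ) / 2)
    (f₁ f₂ : ℝ → ℝ)
    (hf₁ : ∀ ζ : ℝ, 0 < ζ →
      f₁ ζ = (b * Real.log ((1 / γ) * Real.sqrt (a ^ 2 + ζ ^ 2))
        + ζ * Real.arctan (ζ / a)) / (b ^ 2 + ζ ^ 2))
    (hf₂ : ∀ ζ : ℝ, 0 < ζ →
      f₂ ζ = (ζ * Real.log ((1 / γ) * Real.sqrt (a ^ 2 + ζ ^ 2))
        - b * Real.arctan (ζ / a)) / (b ^ 2 + ζ ^ 2))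
    (ϱ : ℝ → ℝ)
    (hϱ : ∀ τ : ℝ, 0 < τ →
      ϱ τ = γ * E / (1 + γ) + (2 * E / Real.pi) *
        ∫ ζ in Set.Ioi (0 : ℝ),
          (ζ * Real.exp (-τ * (σ ^ 2 / 2) * (a ^ 2 + ζ ^ 2)) / (a ^ 2 + ζ ^ 2))
            * Real.exp (-(f₁ ζ)) * Real.sin (f₂ ζ)) :
    Filter.Tendsto (fun τ : ℝ => (E - ϱ τ) / (Real.sqrt τ * (-Real.log τ)))
      (nhdsWithin 0 (Set.Ioi 0)) (nhds (E * σ / Real.sqrt (2 * Real.pi))) := by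
  have hγ0 : 0 < γ := by rw [hγ]; positivity
  have ha2 : 1 + γ = 2 * a := by rw [ha]; ring
  have ha0 : 0 < a := by linarith
  have hba : b = a - γ := by rw [hb, ha]; ring
  set g : ℝ → ℝ := fun y => (Complex.exp (-logQuotient γ (a + y * Complex.I))).im with hg
  have hgf : ∀ ζ : ℝ, 0 < ζ → g ζ = Real.exp (-(f₁ ζ)) * Real.sin (f₂ ζ) := by
    intro ζ hζ
    rw [hf₁ ζ hζ, hf₂ ζ hζ]
    exact exp_neg_logQuotient_vertical_im hγ0 ha0 hba hζ.ne'
  set ψ : ℝ → ℝ := fun y => y * g y / Real.log (2 + |y|) with hψ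
  have hψc : Continuous ψ := by
    refine (continuous_id.mul (continuous_exp_neg_logQuotient_vertical hγ0 ha0)).div ?_ ?_
    · exact Continuous.log (by fun_prop) fun y => by positivity
    · exact fun y => (Real.log_pos (by linarith [abs_nonneg y])).ne'
  have hψlim : Tendsto ψ atTop (𝓝 1) := tendsto_mul_im_div_log hγ0 ha0 hba
  obtain ⟨C, hC⟩ := exists_bound_of_continuous_of_tendsto_atTop hψc hψlim
  set φ : ℝ → ℝ := fun x => ψ x * (Real.log (2 + x) / (a ^ 2 + x ^ 2)) with hφ
  have hφg : ∀ x : ℝ, 0 ≤ x → φ x = x / (a ^ 2 + x ^ 2) * g x := by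
    intro x hx
    have : 0 < Real.log (2 + x) := Real.log_pos (by linarith)
    simp only [hφ, hψ, abs_of_nonneg hx]
    field_simp
  have hφint : IntegrableOn φ (Ioi 0) := integrableOn_mul_log_div ha0 hψc.measurable hC
  have hφtotal : ∫ x in Ioi (0 : ℝ), φ x = π / (4 * a) := by
    refine tendsto_nhds_unique (intervalIntegral_tendsto_integral_Ioi 0 hφint tendsto_id)
      ((tendsto_integral_zhu hγ0 ha2 hba).congr' ?_)
    filter_upwards [eventually_ge_atTop 0] with R hR
    refine intervalIntegral.integral_congr fun x hx => ?_
    rw [uIcc_of_le hR] at hx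
    exact (hφg x hx.1).symm
  have hdiff : ∀ τ : ℝ, 0 < τ → E - ϱ τ = 2 * E / π * ∫ x in Ioi (0 : ℝ),
      φ x * (1 - Real.exp (-((σ / √2 * √τ) ^ 2 * (a ^ 2 + x ^ 2)))) := by
    intro τ hτ
    have hsq : (σ / √2 * √τ) ^ 2 = τ * (σ ^ 2 / 2) := by
      rw [mul_pow, div_pow, Real.sq_sqrt hτ.le, Real.sq_sqrt zero_le_two]
      ring
    have hint : IntegrableOn (fun x => φ x * Real.exp (-(τ * (σ ^ 2 / 2) * (a ^ 2 + x ^ 2))))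
        (Ioi 0) := by
      refine Integrable.mul_bdd (c := 1) hφint (by fun_prop) (ae_of_all _ fun x => ?_)
      rw [Real.norm_of_nonneg (Real.exp_pos _).le, Real.exp_le_one_iff, neg_nonpos]
      positivity
    have hpriced : ∫ ζ in Ioi (0 : ℝ),
        (ζ * Real.exp (-τ * (σ ^ 2 / 2) * (a ^ 2 + ζ ^ 2)) / (a ^ 2 + ζ ^ 2))
          * Real.exp (-(f₁ ζ)) * Real.sin (f₂ ζ)
        = ∫ x in Ioi (0 : ℝ), φ x * Real.exp (-(τ * (σ ^ 2 / 2) * (a ^ 2 + x ^ 2))) := by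
      refine setIntegral_congr_fun measurableSet_Ioi fun ζ (hζ : 0 < ζ) => ?_
      rw [hφg ζ hζ.le, hgf ζ hζ, neg_mul, neg_mul]
      ring
    have hsplit : ∫ x in Ioi (0 : ℝ), φ x * (1 - Real.exp (-(τ * (σ ^ 2 / 2) * (a ^ 2 + x ^ 2))))
        = π / (4 * a)
          - ∫ x in Ioi (0 : ℝ), φ x * Real.exp (-(τ * (σ ^ 2 / 2) * (a ^ 2 + x ^ 2))) := by
      rw [← hφtotal, ← integral_sub hφint hint]
      simp only [mul_sub, mul_one]
    rw [hϱ τ hτ, hpriced, hsq, hsplit, ha2, show γ = 2 * a - 1 by linarith]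
    field_simp
    ring
  have hc : 0 < σ / √2 := by positivity
  have hscale : Tendsto (fun τ : ℝ => σ / √2 * √τ) (𝓝[>] 0) (𝓝[>] 0) := by
    refine tendsto_nhdsWithin_iff.2 ⟨?_, ?_⟩
    · have : Continuous fun τ : ℝ => σ / √2 * √τ := by fun_prop
      simpa using (this.tendsto 0).mono_left nhdsWithin_le_nhds
    · filter_upwards [self_mem_nhdsWithin] with τ (hτ : 0 < τ)
      exact mul_pos hc (Real.sqrt_pos.2 hτ)
  have hcore := (tendsto_integral_one_sub_exp_div ha0 hψc.measurable hC hψlim).comp hscale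
  have hlim := (hcore.mul (tendsto_mul_neg_log_div hc)).const_mul (2 * E / π)
  have hval : 2 * E / π * (√π * (σ / √2 / 2)) = E * σ / √(2 * π) := by
    rw [Real.sqrt_mul zero_le_two]
    have hπ : √π ^ 2 = π := Real.sq_sqrt pi_pos.le
    have hπ0 : 0 < √π := Real.sqrt_pos.2 pi_pos
    field_simp
    exact hπ
  rw [hval] at hlim
  refine hlim.congr' ?_
  have hlogc : ∀ᶠ τ in 𝓝[>] (0 : ℝ), Real.log (σ / √2 * √τ) < 0 :=
    hscale.eventually (tendsto_log_nhdsGT_zero.eventually_lt_atBot 0)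
  filter_upwards [self_mem_nhdsWithin, hlogc] with τ (hτ : 0 < τ) hlogτ
  have hne : σ / √2 * √τ * -Real.log (σ / √2 * √τ) ≠ 0 :=
    (mul_pos (mul_pos hc (Real.sqrt_pos.2 hτ)) (neg_pos.2 hlogτ)).ne'
  rw [hdiff τ hτ, Function.comp_apply, div_mul_div_cancel₀ hne, ← mul_div_assoc]
end

section
/- Let r, σ > 0, γ = 2r/σ², a = (1+γ)/2, b = (1-γ)/2, and define f₁*(ζ) = [b·ln((1/γ)·√(a²+ζ²)) + ζ·arctan(ζ/a)]/(b²+ζ²) and f₂*(ζ) = [ζ·ln((1/γ)·√(a²+ζ²)) - b·arctan(ζ/a)]/(b²+ζ²) for ζ > 0. Then γ/(1+γ) + (2/π)·∫₀^∞ [ζ/(a²+ζ²)]·e^{-f₁*(ζ)}·sin(f₂*(ζ)) dζ = 1; i.e., Zhu's boundary formula ϱ^{Zhu}(τ) evaluated at τ = 0 equals the strike E. -/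
open MeasureTheory Real Filter Topology Set

open Asymptotics Bornology in
/-- Quadrant form of Cauchy's theorem. -/
lemma integral_re_imaginary_axis_eq_zero {f : ℂ → ℂ}
    (hd : ∀ z : ℂ, 0 ≤ z.re → DifferentiableAt ℂ f z)
    (hO : f =O[cobounded ℂ] fun z => ‖z‖ ^ (-(3 / 2) : ℝ))
    (him : ∀ᵐ x : ℝ, 0 < x → (f x).im = 0) :
    IntegrableOn (fun y : ℝ => (f (y * Complex.I)).re) (Ioi 0) ∧
      ∫ y in Ioi (0 : ℝ), (f (y * Complex.I)).re = 0 := by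
  have hc : Continuous fun y : ℝ => f (y * Complex.I) := by
    rw [continuous_iff_continuousAt]
    intro y
    have h1 : ContinuousAt f (y * Complex.I) := (hd _ (by simp)).continuousAt
    exact ContinuousAt.comp (f := fun y : ℝ => (y * Complex.I : ℂ)) h1
      (by fun_prop)
  have htend : Tendsto (fun y : ℝ => (y * Complex.I : ℂ)) atTop (cobounded ℂ) := by
    rw [← tendsto_norm_atTop_iff_cobounded]
    simpa using tendsto_abs_atTop_atTop
  have hint : IntegrableOn (fun y : ℝ => (f (y * Complex.I)).re) (Ioi 0) := by
    have h1 : (fun y : ℝ => (f (y * Complex.I)).re) =O[atTop]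
        fun y : ℝ => y ^ (-(3 / 2) : ℝ) := by
      refine (IsBigO.of_norm_le fun y => ?_ : (fun y : ℝ => (f (y * Complex.I)).re) =O[atTop]
        fun y : ℝ => ‖f (y * Complex.I)‖).trans ?_
      · simpa using Complex.abs_re_le_norm _
      · refine ((hO.comp_tendsto htend).norm_left).congr' EventuallyEq.rfl ?_
        filter_upwards [eventually_ge_atTop 0] with y hy
        simp [abs_of_nonneg hy]
    refine (LocallyIntegrableOn.integrableOn_of_isBigO_atTop (a := 0)
      ((Complex.continuous_re.comp hc).locallyIntegrable.locallyIntegrableOn _) h1 ?_).mono_set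
      Ioi_subset_Ici_self
    exact ⟨Ioi 1, Ioi_mem_atTop _, integrableOn_Ioi_rpow_of_lt (by norm_num) one_pos⟩
  refine ⟨hint, tendsto_nhds_unique (intervalIntegral_tendsto_integral_Ioi 0 hint tendsto_id) ?_⟩
  obtain ⟨C, hC⟩ := hO.bound
  obtain ⟨R₀, -, hR₀⟩ := (hasBasis_cobounded_norm (E := ℂ)).eventually_iff.1 hC
  have hlim : Tendsto (fun R : ℝ => 2 * (|C| * R ^ (-(1 / 2) : ℝ))) atTop (𝓝 0) := by
    simpa using ((tendsto_rpow_neg_atTop (y := 1 / 2) (by norm_num)).const_mul |C|).const_mul 2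
  refine squeeze_zero_norm' ?_ hlim
  filter_upwards [eventually_ge_atTop R₀, eventually_gt_atTop 0] with R hR hR0
  have hb : ∀ z : ℂ, R ≤ ‖z‖ → ‖f z‖ ≤ |C| * R ^ (-(3 / 2) : ℝ) := by
    intro z hz
    refine (hR₀ (hR.trans hz)).trans ?_
    have h2 : ‖‖z‖ ^ (-(3 / 2) : ℝ)‖ ≤ R ^ (-(3 / 2) : ℝ) := by
      rw [Real.norm_of_nonneg (by positivity)]
      exact Real.rpow_le_rpow_of_nonpos hR0 hz (by norm_num)
    gcongr
    exact le_abs_self C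
  have hpow : R ^ (-(3 / 2) : ℝ) * R = R ^ (-(1 / 2) : ℝ) := by
    rw [← Real.rpow_add_one hR0.ne']; norm_num
  have hrect := Complex.integral_boundary_rect_eq_zero_of_differentiableOn f 0
    (R + R * Complex.I) (fun z hz => (hd z (by
      have := hz.1
      simp [uIcc_of_le hR0.le] at this
      exact this.1)).differentiableWithinAt)
  simp only [Complex.zero_re, Complex.zero_im, Complex.add_re, Complex.ofReal_re, Complex.mul_re,
    Complex.I_re, Complex.I_im, Complex.ofReal_im, Complex.add_im, Complex.mul_im, mul_zero,
    mul_one, zero_mul, sub_zero, add_zero, zero_add, Complex.ofReal_zero, smul_eq_mul] at hrect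
  have hT : ‖∫ x in (0 : ℝ)..R, f (x + R * Complex.I)‖ ≤ |C| * R ^ (-(1 / 2) : ℝ) := by
    rw [← hpow, ← mul_assoc]
    have := intervalIntegral.norm_integral_le_of_norm_le_const (a := 0) (b := R)
      (f := fun x : ℝ => f (x + R * Complex.I)) (fun x _ => hb _ (by
        refine le_trans ?_ (Complex.abs_im_le_norm _)
        simpa using le_abs_self R))
    simpa [abs_of_pos hR0] using this
  have hS : ‖∫ y in (0 : ℝ)..R, f (R + y * Complex.I)‖ ≤ |C| * R ^ (-(1 / 2) : ℝ) := by
    rw [← hpow, ← mul_assoc]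
    have := intervalIntegral.norm_integral_le_of_norm_le_const (a := 0) (b := R)
      (f := fun y : ℝ => f (R + y * Complex.I)) (fun y _ => hb _ (by
        refine le_trans ?_ (Complex.abs_re_le_norm _)
        simpa using le_abs_self R))
    simpa [abs_of_pos hR0] using this
  have hB : (∫ x in (0 : ℝ)..R, f x).im = 0 := by
    have hcont : ContinuousOn (fun x : ℝ => f x) (uIcc 0 R) := fun x hx => by
      rw [uIcc_of_le hR0.le] at hx
      exact (ContinuousAt.comp (f := fun x : ℝ => (x : ℂ)) (hd _ (by simpa using hx.1)).continuousAt
        (by fun_prop)).continuousWithinAt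
    have h1 := Complex.imCLM.intervalIntegral_comp_comm (hcont.intervalIntegrable (μ := volume))
    have h2 : ∫ x in (0 : ℝ)..R, Complex.imCLM (f x) = 0 := by
      rw [intervalIntegral.integral_congr_ae (g := fun _ => (0 : ℝ)), intervalIntegral.integral_zero]
      filter_upwards [him] with x hx hxR
      rw [uIoc_of_le hR0.le] at hxR
      simpa using hx hxR.1
    rw [h2] at h1
    simpa using h1.symm
  have hL : ∫ y in (0 : ℝ)..R, (f (y * Complex.I)).re
      = (∫ y in (0 : ℝ)..R, f (y * Complex.I)).re := by
    simpa using Complex.reCLM.intervalIntegral_comp_comm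
      (hc.intervalIntegrable (μ := volume) 0 R)
  have him' := congrArg Complex.im hrect
  simp only [Complex.sub_im, Complex.add_im, Complex.I_mul_im, Complex.zero_im, hB] at him'
  have e1 := (Complex.abs_im_le_norm _).trans hT
  have e2 := (Complex.abs_re_le_norm _).trans hS
  rw [id, hL, Real.norm_eq_abs]
  rw [abs_le] at e1 e2 ⊢
  constructor <;> linarith [e1.1, e1.2, e2.1, e2.2]

open Asymptotics Bornology in
lemma isBigO_add_const_inv_cobounded (c : ℂ) :
    (fun z : ℂ => (z + c)⁻¹) =O[cobounded ℂ] fun z => ‖z‖ ^ (-1 : ℝ) := by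
  refine IsBigO.of_bound 2 ?_
  filter_upwards [eventually_cobounded_le_norm (2 * ‖c‖ + 1)] with z hz
  have h1 : ‖z‖ ≤ ‖z + c‖ + ‖c‖ := by simpa using norm_sub_le (z + c) c
  have h0 : 0 < ‖z‖ := by linarith [norm_nonneg c]
  rw [Real.rpow_neg_one, norm_inv, norm_inv, norm_norm]
  rw [show 2 * ‖z‖⁻¹ = (‖z‖ / 2)⁻¹ by field_simp]
  exact inv_anti₀ (by positivity) (by linarith)

lemma Complex.norm_log_le_abs_log_norm_add_pi (z : ℂ) : ‖Complex.log z‖ ≤ |Real.log ‖z‖| + π := by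
  refine (Complex.norm_le_abs_re_add_abs_im _).trans ?_
  rw [Complex.log_re, Complex.log_im]
  gcongr
  exact Complex.abs_arg_le_pi z

open Asymptotics Bornology in
lemma isBigO_log_affine_cobounded (a : ℂ) {γ : ℝ} (hγ : 0 < γ) :
    (fun z : ℂ => Complex.log ((a + z) / γ)) =O[cobounded ℂ] fun z => ‖z‖ ^ (1 / 2 : ℝ) := by
  refine IsBigO.of_bound ((2 / γ) ^ (1 / 2 : ℝ) / (1 / 2) + π) ?_
  filter_upwards [eventually_cobounded_le_norm (‖a‖ + γ + 1)] with z hz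
  have hz1 : 1 ≤ ‖z‖ := by linarith [norm_nonneg a]
  have h1 : ‖z‖ ≤ ‖a + z‖ + ‖a‖ := by simpa using norm_sub_le (a + z) a
  have h2 : ‖a + z‖ ≤ ‖a‖ + ‖z‖ := norm_add_le _ _
  have hn : ‖(a + z) / γ‖ = ‖a + z‖ / γ := by simp [abs_of_pos hγ]
  have h3 : 1 ≤ ‖(a + z) / γ‖ := by
    rw [hn, one_le_div hγ]; linarith
  have h4 : ‖(a + z) / γ‖ ≤ 2 / γ * ‖z‖ := by
    rw [hn, div_mul_eq_mul_div]; gcongr; linarith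
  refine (Complex.norm_log_le_abs_log_norm_add_pi _).trans ?_
  rw [abs_of_nonneg (Real.log_nonneg h3), Real.norm_of_nonneg (by positivity), add_mul]
  have h5 : Real.log ‖(a + z) / γ‖ ≤ (2 / γ * ‖z‖) ^ (1 / 2 : ℝ) / (1 / 2) :=
    (Real.log_le_rpow_div (by positivity) (by norm_num : (0 : ℝ) < 1 / 2)).trans (by gcongr)
  rw [Real.mul_rpow (by positivity) (by positivity)] at h5
  have h6 : 1 ≤ ‖z‖ ^ (1 / 2 : ℝ) := Real.one_le_rpow hz1 (by norm_num)
  have h7 : π * 1 ≤ π * ‖z‖ ^ (1 / 2 : ℝ) := by gcongr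
  linarith

lemma integral_Ioi_two_mul_sq_div_sq {a : ℝ} (ha : 0 < a) :
    IntegrableOn (fun ζ : ℝ => 2 * a * ζ ^ 2 / (a ^ 2 + ζ ^ 2) ^ 2) (Ioi 0) ∧
      ∫ ζ in Ioi (0 : ℝ), 2 * a * ζ ^ 2 / (a ^ 2 + ζ ^ 2) ^ 2 = π / 2 := by
  have hderiv : ∀ x ∈ Ici (0 : ℝ), HasDerivAt
      (fun ζ : ℝ => Real.arctan (ζ / a) - a * ζ / (a ^ 2 + ζ ^ 2))
      (2 * a * x ^ 2 / (a ^ 2 + x ^ 2) ^ 2) x := by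
    intro x _
    have hp : a ^ 2 + x ^ 2 ≠ 0 := by positivity
    have h1 := ((hasDerivAt_id x).div_const a).arctan
    have h2 := ((hasDerivAt_id x).const_mul a).div ((hasDerivAt_pow 2 x).const_add (a ^ 2)) hp
    refine (h1.sub h2).congr_deriv ?_
    have : 1 + (x / a) ^ 2 ≠ 0 := by positivity
    simp only [id]
    field_simp
    norm_num
    ring
  have hlim : Tendsto (fun ζ : ℝ => Real.arctan (ζ / a) - a * ζ / (a ^ 2 + ζ ^ 2)) atTop
      (𝓝 (π / 2)) := by
    have h1 : Tendsto (fun ζ : ℝ => Real.arctan (ζ / a)) atTop (𝓝 (π / 2)) :=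
      (Real.tendsto_arctan_atTop.mono_right nhdsWithin_le_nhds).comp
        (tendsto_id.atTop_div_const ha)
    have h2 : Tendsto (fun ζ : ℝ => a * ζ / (a ^ 2 + ζ ^ 2)) atTop (𝓝 0) := by
      refine squeeze_zero' (g := fun ζ : ℝ => a / ζ) ?_ ?_ (tendsto_const_nhds.div_atTop tendsto_id)
      · filter_upwards [eventually_ge_atTop 0] with x hx
        positivity
      · filter_upwards [eventually_gt_atTop 0] with x hx
        rw [div_le_div_iff₀ (by positivity) hx]
        nlinarith [pow_pos ha 3]
    simpa using h1.sub h2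
  have hpos : ∀ x ∈ Ioi (0 : ℝ), 0 ≤ 2 * a * x ^ 2 / (a ^ 2 + x ^ 2) ^ 2 :=
    fun x _ => by positivity
  refine ⟨integrableOn_Ioi_deriv_of_nonneg' hderiv hpos hlim, ?_⟩
  rw [integral_Ioi_of_hasDerivAt_of_nonneg' hderiv hpos hlim]
  simp

/-- The analytic continuation of `z ↦ log ((a + z) / γ) / (b + z)` across `z = -b`, where
`γ = a - b`. -/
noncomputable def zhuExponent (a b : ℝ) : ℂ → ℂ :=
  dslope (fun z : ℂ => Complex.log ((a + z) / (a - b : ℝ))) (-b)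

lemma zhuExponent_of_ne {a b : ℝ} (hab : 0 < a - b) {z : ℂ} (hz : b + z ≠ 0) :
    zhuExponent a b z = Complex.log ((a + z) / (a - b : ℝ)) / (b + z) := by
  have h1 : z ≠ -b := fun h => hz (by rw [h]; ring)
  have h2 : ((a : ℂ) + -b) / (a - b : ℝ) = 1 := by
    rw [show (a : ℂ) + -b = (a - b : ℝ) by push_cast; ring]
    exact div_self (by exact_mod_cast hab.ne')
  rw [zhuExponent, dslope_of_ne _ h1, slope_def_field, h2, Complex.log_one, sub_zero,
    sub_neg_eq_add, add_comm z]

open Asymptotics Bornology in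
lemma zhuExponent_isBigO {a b : ℝ} (hab : 0 < a - b) :
    zhuExponent a b =O[cobounded ℂ] fun z => ‖z‖ ^ (-(1 / 2) : ℝ) := by
  refine ((isBigO_log_affine_cobounded (a : ℂ) hab).mul
    (isBigO_add_const_inv_cobounded (b : ℂ))).congr' ?_ ?_
  · filter_upwards [eventually_cobounded_le_norm (‖(b : ℂ)‖ + 1)] with z hz
    rw [zhuExponent_of_ne hab, div_eq_mul_inv _ (_ + _), add_comm z]
    intro h
    rw [eq_neg_of_add_eq_zero_right h, norm_neg] at hz
    linarith
  · filter_upwards [eventually_cobounded_le_norm 1] with z hz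
    rw [← Real.rpow_add (by linarith)]
    norm_num

lemma isOpen_neg_lt_re (a : ℝ) : IsOpen {z : ℂ | -a < z.re} :=
  isOpen_lt continuous_const Complex.continuous_re

lemma zhuExponent_differentiableOn {a b : ℝ} (hab : 0 < a - b) :
    DifferentiableOn ℂ (zhuExponent a b) {z : ℂ | -a < z.re} := by
  refine (Complex.differentiableOn_dslope ((isOpen_neg_lt_re a).mem_nhds ?_)).2 ?_
  · simp; linarith
  · intro z hz
    refine DifferentiableAt.differentiableWithinAt (DifferentiableAt.clog (by fun_prop) ?_)
    left
    have : 0 < a + z.re := by linarith [show -a < z.re from hz]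
    rw [Complex.div_ofReal_re]
    simpa using div_pos this hab

open Asymptotics Bornology in
lemma exp_neg_zhuExponent_sub_one_isBigO {a b : ℝ} (hab : 0 < a - b) :
    (fun z => Complex.exp (-zhuExponent a b z) - 1) =O[cobounded ℂ]
      fun z => ‖z‖ ^ (-(1 / 2) : ℝ) := by
  have h0 : Tendsto (zhuExponent a b) (cobounded ℂ) (𝓝 0) :=
    (zhuExponent_isBigO hab).trans_tendsto
      ((tendsto_rpow_neg_atTop (by norm_num)).comp tendsto_norm_cobounded_atTop)
  refine IsBigO.trans (IsBigO.of_bound 2 ?_) (zhuExponent_isBigO hab)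
  filter_upwards [h0.norm.eventually (Iic_mem_nhds (by simp : ‖(0 : ℂ)‖ < 1))] with z hz
  simpa using Complex.norm_exp_sub_one_le (x := -zhuExponent a b z) (by simpa using hz)

/-- The function `e^{-K} - 1`, with `K` the continued exponent, corrected by a multiple of
`2a / (a + z)` so as to vanish at `z = a`. -/
noncomputable def zhuCorrected (a b : ℝ) (z : ℂ) : ℂ :=
  Complex.exp (-zhuExponent a b z) - 1 + (1 - (a - b : ℝ) / (2 * a : ℝ)) * (2 * a / (z + a))

lemma exp_neg_zhuExponent_self {a b : ℝ} (ha : 0 < a) (hab : 0 < a - b) (h1 : a + b = 1) :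
    Complex.exp (-zhuExponent a b a) = (a - b : ℝ) / (2 * a : ℝ) := by
  have hb : (b : ℂ) + a = 1 := by exact_mod_cast (by linarith : b + a = 1)
  have hne : ((a : ℂ) + a) / (a - b : ℝ) ≠ 0 := by
    rw [← Complex.ofReal_add, ← Complex.ofReal_div]
    exact_mod_cast (by positivity : (a + a) / (a - b) ≠ 0)
  rw [zhuExponent_of_ne hab (by simp [hb]), hb, div_one, Complex.exp_neg, Complex.exp_log hne,
    inv_div]
  push_cast
  ring

lemma zhuCorrected_self {a b : ℝ} (ha : 0 < a) (hab : 0 < a - b) (h1 : a + b = 1) :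
    zhuCorrected a b a = 0 := by
  have h2 : (2 * a : ℂ) / (a + a) = 1 := by
    rw [← two_mul]
    exact div_self (by exact_mod_cast (by positivity : 2 * a ≠ 0))
  rw [zhuCorrected, exp_neg_zhuExponent_self ha hab h1, h2]
  ring

open Asymptotics Bornology in
lemma zhuCorrected_isBigO {a b : ℝ} (hab : 0 < a - b) :
    zhuCorrected a b =O[cobounded ℂ] fun z => ‖z‖ ^ (-(1 / 2) : ℝ) := by
  refine (exp_neg_zhuExponent_sub_one_isBigO hab).add (IsBigO.const_mul_left ?_ _)
  simp only [div_eq_mul_inv (2 * (a : ℂ))]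
  refine ((isBigO_add_const_inv_cobounded (a : ℂ)).const_mul_left _).trans (IsBigO.of_bound 1 ?_)
  filter_upwards [eventually_cobounded_le_norm 1] with z hz
  rw [Real.norm_of_nonneg (by positivity), Real.norm_of_nonneg (by positivity), one_mul]
  exact Real.rpow_le_rpow_of_exponent_le hz (by norm_num)

lemma add_ofReal_ne_zero {a : ℝ} {z : ℂ} (hz : -a < z.re) : z + a ≠ 0 := fun h => by
  have := congrArg Complex.re h
  simp at this
  linarith

lemma zhuCorrected_differentiableOn {a b : ℝ} (hab : 0 < a - b) :
    DifferentiableOn ℂ (zhuCorrected a b) {z : ℂ | -a < z.re} := by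
  refine (((zhuExponent_differentiableOn hab).neg.cexp).sub_const 1).add
    (DifferentiableOn.const_mul (DifferentiableOn.div (by fun_prop) (by fun_prop) ?_) _)
  exact fun z hz => add_ofReal_ne_zero hz

/-- The analytic continuation of `z / (a ^ 2 - z ^ 2) * zhuCorrected a b z` across `z = a`. -/
noncomputable def zhuKernel (a b : ℝ) (z : ℂ) : ℂ :=
  -(z * (z + a)⁻¹ * dslope (zhuCorrected a b) a z)

lemma zhuKernel_of_ne {a b : ℝ} (ha : 0 < a) (hab : 0 < a - b) (h1 : a + b = 1) {z : ℂ}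
    (hz : z ≠ a) (hz' : z + a ≠ 0) :
    zhuKernel a b z = z / (a ^ 2 - z ^ 2) * zhuCorrected a b z := by
  have h2 : z - a ≠ 0 := sub_ne_zero.2 hz
  have h3 : (a : ℂ) ^ 2 - z ^ 2 ≠ 0 := by
    rw [show (a : ℂ) ^ 2 - z ^ 2 = -((z - a) * (z + a)) by ring]
    exact neg_ne_zero.2 (mul_ne_zero h2 hz')
  rw [zhuKernel, dslope_of_ne _ hz, slope_def_field, zhuCorrected_self ha hab h1]
  field_simp
  ring

lemma zhuKernel_differentiableAt {a b : ℝ} (ha : 0 < a) (hab : 0 < a - b) {z : ℂ}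
    (hz : 0 ≤ z.re) : DifferentiableAt ℂ (zhuKernel a b) z := by
  have hz' : -a < z.re := by linarith
  have h1 := (Complex.differentiableOn_dslope ((isOpen_neg_lt_re a).mem_nhds
    (show -a < (a : ℂ).re by simp; linarith))).2 (zhuCorrected_differentiableOn hab)
  have h2 := h1.differentiableAt ((isOpen_neg_lt_re a).mem_nhds hz')
  have h3 : DifferentiableAt ℂ (fun z : ℂ => (z + a)⁻¹) z :=
    (differentiableAt_id.add_const _).inv (add_ofReal_ne_zero hz')
  exact ((differentiableAt_id.mul h3).mul h2).neg

open Asymptotics Bornology in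
lemma zhuKernel_isBigO {a b : ℝ} (ha : 0 < a) (hab : 0 < a - b) (h1 : a + b = 1) :
    zhuKernel a b =O[cobounded ℂ] fun z => ‖z‖ ^ (-(3 / 2) : ℝ) := by
  have hid : (fun z : ℂ => z) =O[cobounded ℂ] fun z => ‖z‖ := (isBigO_refl _ _).norm_right
  refine (((hid.mul (isBigO_add_const_inv_cobounded (a : ℂ))).mul
    ((isBigO_add_const_inv_cobounded (-a : ℂ)).mul (zhuCorrected_isBigO hab))).neg_left).congr' ?_ ?_
  · filter_upwards [eventually_cobounded_le_norm (‖(a : ℂ)‖ + 1)] with z hz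
    have hne : z ≠ a := by rintro rfl; linarith
    rw [zhuKernel, dslope_of_ne _ hne, slope_def_field, zhuCorrected_self ha hab h1]
    ring
  · filter_upwards [eventually_cobounded_le_norm 1] with z hz
    have hz0 : 0 < ‖z‖ := by linarith
    nth_rewrite 1 [← Real.rpow_one ‖z‖]
    rw [← Real.rpow_add hz0, ← Real.rpow_add hz0, ← Real.rpow_add hz0]
    norm_num

lemma zhuKernel_ofReal_im {a b : ℝ} (ha : 0 < a) (hab : 0 < a - b) (h1 : a + b = 1) {x : ℝ}
    (hx : 0 < x) (hxa : x ≠ a) (hxb : x ≠ -b) : (zhuKernel a b x).im = 0 := by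
  have hne : (x : ℂ) + a ≠ 0 := add_ofReal_ne_zero (by simp; linarith)
  have hbx : (b : ℂ) + x ≠ 0 := by
    exact_mod_cast fun h : b + x = 0 => hxb (by linarith)
  rw [zhuKernel_of_ne ha hab h1 (by exact_mod_cast hxa) hne, zhuCorrected,
    zhuExponent_of_ne hab hbx, ← Complex.ofReal_add, ← Complex.ofReal_div,
    ← Complex.ofReal_log (by positivity)]
  norm_cast

lemma zhuExponent_mul_I {a b y : ℝ} (ha : 0 < a) (hab : 0 < a - b) (hy : 0 < y) :
    zhuExponent a b (y * Complex.I) =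
      ((b * Real.log ((1 / (a - b)) * √(a ^ 2 + y ^ 2)) + y * Real.arctan (y / a))
          / (b ^ 2 + y ^ 2) : ℝ)
        - ((y * Real.log ((1 / (a - b)) * √(a ^ 2 + y ^ 2)) - b * Real.arctan (y / a))
          / (b ^ 2 + y ^ 2) : ℝ) * Complex.I := by
  have hne : (b : ℂ) + y * Complex.I ≠ 0 := fun h => by
    have := congrArg Complex.im h
    simp at this
    linarith
  have hlog : Complex.log ((a + y * Complex.I) / (a - b : ℝ)) =
      (Real.log ((1 / (a - b)) * √(a ^ 2 + y ^ 2)) : ℝ) + (Real.arctan (y / a) : ℝ) * Complex.I := by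
    apply Complex.ext
    · rw [Complex.log_re, norm_div, Complex.norm_add_mul_I, Complex.norm_real,
        Real.norm_of_nonneg hab.le, Complex.add_re, Complex.re_ofReal_mul, Complex.I_re,
        Complex.ofReal_re, mul_zero, add_zero, div_eq_inv_mul, one_div]
    · have harg : Complex.arg (a + y * Complex.I) = Real.arctan (y / a) := by
        have h := Complex.tan_arg (a + y * Complex.I)
        have h' := Complex.abs_arg_lt_pi_div_two_iff.2
          (Or.inl (by simpa using ha) : 0 < (a + y * Complex.I).re ∨ a + y * Complex.I = 0)
        rw [abs_lt] at h'
        rw [← Real.arctan_tan h'.1 h'.2, h]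
        simp
      rw [Complex.log_im, div_eq_mul_inv, ← Complex.ofReal_inv,
        Complex.arg_mul_real (inv_pos.2 hab), harg, Complex.add_im, Complex.im_ofReal_mul,
        Complex.I_im, Complex.ofReal_im, mul_one, zero_add]
  rw [zhuExponent_of_ne hab hne, hlog, div_eq_iff hne]
  have h2 : b ^ 2 + y ^ 2 ≠ 0 := by positivity
  have h3 : (b : ℂ) ^ 2 + y ^ 2 ≠ 0 := by exact_mod_cast h2
  push_cast
  generalize (Real.log (1 / (a - b) * √(a ^ 2 + y ^ 2)) : ℂ) = L
  field_simp
  ring_nf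
  simp only [Complex.I_sq]
  ring

lemma zhuKernel_mul_I_re {a b y : ℝ} (ha : 0 < a) (hab : 0 < a - b) (h1 : a + b = 1)
    (hy : 0 < y) :
    (zhuKernel a b (y * Complex.I)).re =
      (1 - (a - b) / (2 * a)) * (2 * a * y ^ 2 / (a ^ 2 + y ^ 2) ^ 2) -
      y / (a ^ 2 + y ^ 2) *
        Real.exp (-((b * Real.log ((1 / (a - b)) * √(a ^ 2 + y ^ 2)) + y * Real.arctan (y / a))
          / (b ^ 2 + y ^ 2))) *
        Real.sin ((y * Real.log ((1 / (a - b)) * √(a ^ 2 + y ^ 2)) - b * Real.arctan (y / a))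
          / (b ^ 2 + y ^ 2)) := by
  have hne : (y : ℂ) * Complex.I ≠ a := fun h => by
    have := congrArg Complex.re h
    simp at this
    linarith
  have hne' : (y : ℂ) * Complex.I + a ≠ 0 := add_ofReal_ne_zero (by simpa using ha)
  have hp : a ^ 2 + y ^ 2 ≠ 0 := by positivity
  rw [zhuKernel_of_ne ha hab h1 hne hne', zhuCorrected, zhuExponent_mul_I ha hab hy]
  generalize (b * Real.log ((1 / (a - b)) * √(a ^ 2 + y ^ 2)) + y * Real.arctan (y / a))
          / (b ^ 2 + y ^ 2) = p
  generalize (y * Real.log ((1 / (a - b)) * √(a ^ 2 + y ^ 2)) - b * Real.arctan (y / a))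
          / (b ^ 2 + y ^ 2) = q
  have e1 : (y * Complex.I : ℂ) / (a ^ 2 - (y * Complex.I) ^ 2)
      = (y / (a ^ 2 + y ^ 2) : ℝ) * Complex.I := by
    rw [mul_pow, Complex.I_sq]; push_cast; ring
  have e2 : (2 * a : ℂ) / (y * Complex.I + a) =
      (2 * a ^ 2 / (a ^ 2 + y ^ 2) : ℝ) - (2 * a * y / (a ^ 2 + y ^ 2) : ℝ) * Complex.I := by
    have h3 : (a : ℂ) ^ 2 + y ^ 2 ≠ 0 := by exact_mod_cast hp
    rw [div_eq_iff hne']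
    push_cast
    field_simp
    ring_nf
    simp only [Complex.I_sq]
    ring
  have e3 : Complex.exp (-((p : ℂ) - q * Complex.I)) =
      (Real.exp (-p) * Real.cos q : ℝ) + (Real.exp (-p) * Real.sin q : ℝ) * Complex.I := by
    rw [show -((p : ℂ) - q * Complex.I) = (-p : ℝ) + q * Complex.I by push_cast; ring,
      Complex.exp_add_mul_I]
    push_cast
    ring
  rw [e1, e2, e3, ← Complex.ofReal_div, ← Complex.ofReal_one, ← Complex.ofReal_sub]
  simp only [Complex.mul_re, Complex.mul_im, Complex.add_re, Complex.add_im, Complex.sub_re,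
    Complex.sub_im, Complex.ofReal_re, Complex.ofReal_im, Complex.I_re, Complex.I_im]
  field_simp
  ring

/-- Zhu's boundary formula evaluated at `τ = 0` equals the strike `E`:
`γ/(1+γ) + (2/π)·∫₀^∞ [ζ/(a²+ζ²)]·e^{-f₁*(ζ)}·sin(f₂*(ζ)) dζ = 1`. -/
theorem stmt_5 (r σ : ℝ) (hr : 0 < r) (hσ : 0 < σ)
    (γ a b : ℝ) (hγ : γ = 2 * r / σ ^ 2) (ha : a = (1 + γ) / 2) (hb : b = (1 - γ) / 2)
    (f₁ f₂ : ℝ → ℝ)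
    (hf₁ : ∀ ζ : ℝ, 0 < ζ →
      f₁ ζ = (b * Real.log ((1 / γ) * Real.sqrt (a ^ 2 + ζ ^ 2))
        + ζ * Real.arctan (ζ / a)) / (b ^ 2 + ζ ^ 2))
    (hf₂ : ∀ ζ : ℝ, 0 < ζ →
      f₂ ζ = (ζ * Real.log ((1 / γ) * Real.sqrt (a ^ 2 + ζ ^ 2))
        - b * Real.arctan (ζ / a)) / (b ^ 2 + ζ ^ 2)) :
    γ / (1 + γ) + (2 / Real.pi) *
      (∫ ζ in Set.Ioi (0 : ℝ),
        (ζ / (a ^ 2 + ζ ^ 2)) * Real.exp (-(f₁ ζ)) * Real.sin (f₂ ζ)) = 1 := by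
  have hγ0 : 0 < γ := hγ ▸ by positivity
  have ha0 : 0 < a := by rw [ha]; positivity
  have hγab : γ = a - b := by rw [ha, hb]; ring
  have hab : 0 < a - b := hγab ▸ hγ0
  have h1 : a + b = 1 := by rw [ha, hb]; ring
  have h2a : 1 + γ = 2 * a := by rw [ha]; ring
  have him : ∀ᵐ x : ℝ, 0 < x → (zhuKernel a b x).im = 0 := by
    filter_upwards [Measure.ae_ne volume a, Measure.ae_ne volume (-b)] with x hxa hxb hx
    exact zhuKernel_ofReal_im ha0 hab h1 hx hxa hxb
  obtain ⟨hi, h0⟩ := integral_re_imaginary_axis_eq_zero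
    (fun z hz => zhuKernel_differentiableAt ha0 hab hz) (zhuKernel_isBigO ha0 hab h1) him
  obtain ⟨hj, hπ⟩ := integral_Ioi_two_mul_sq_div_sq ha0
  have key : ∫ ζ in Ioi (0 : ℝ), (ζ / (a ^ 2 + ζ ^ 2)) * Real.exp (-(f₁ ζ)) * Real.sin (f₂ ζ)
      = ∫ ζ in Ioi (0 : ℝ), ((1 - (a - b) / (2 * a)) * (2 * a * ζ ^ 2 / (a ^ 2 + ζ ^ 2) ^ 2)
        - (zhuKernel a b (ζ * Complex.I)).re) := by
    refine setIntegral_congr_fun measurableSet_Ioi fun ζ hζ => ?_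
    rw [zhuKernel_mul_I_re ha0 hab h1 hζ, hf₁ ζ hζ, hf₂ ζ hζ, hγab]
    ring
  rw [key, integral_sub (hj.const_mul _) hi, integral_const_mul, hπ, h0, h2a, hγab]
  field_simp
  ring
end

section
/- Let E, r, σ > 0 and let ϱ^{Zhu}(τ) = γE/(1+γ) + (2E/π)·∫₀^∞ [ζ·e^{-τ(σ²/2)(a²+ζ²)}/(a²+ζ²)]·e^{-f₁*(ζ)}·sin(f₂*(ζ)) dζ with γ = 2r/σ², a = (1+γ)/2, b = (1-γ)/2 and f₁*, f₂* as in Zhu's formula. Then lim_{τ→∞} ϱ^{Zhu}(τ) = γE/(1+γ), i.e. Zhu's early exercise boundary converges to the perpetual put option boundary as time to maturity tends to infinity. -/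
open MeasureTheory Real Filter Topology Set

/-- For `b = (1 - γ) / 2`, the exponent `-f₁*` in Zhu's formula is bounded above on `(0, ∞)`. -/
theorem exists_neg_zhuExponent_le {γ a b : ℝ} (hγ : 0 < γ) (ha : a = (1 + γ) / 2)
    (hb : b = (1 - γ) / 2) :
    ∃ C : ℝ, ∀ ζ : ℝ, 0 < ζ →
      -((b * Real.log ((1 / γ) * Real.sqrt (a ^ 2 + ζ ^ 2))
        + ζ * Real.arctan (ζ / a)) / (b ^ 2 + ζ ^ 2)) ≤ C := by
  have ha0 : 0 < a := by rw [ha]; linarith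
  have harctan : ∀ ζ : ℝ, 0 < ζ → 0 ≤ ζ * Real.arctan (ζ / a) := fun ζ hζ =>
    mul_nonneg hζ.le (Real.arctan_nonneg.2 (div_nonneg hζ.le ha0.le))
  have hsq : a ^ 2 = b ^ 2 + γ := by rw [ha, hb]; ring
  rcases le_or_gt 0 b with hb0 | hb0
  · refine ⟨0, fun ζ hζ => ?_⟩
    have hsqrt : a ≤ Real.sqrt (a ^ 2 + ζ ^ 2) := Real.le_sqrt_of_sq_le (by nlinarith)
    have hlog : 0 ≤ Real.log ((1 / γ) * Real.sqrt (a ^ 2 + ζ ^ 2)) := by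
      apply Real.log_nonneg
      rw [one_div, inv_mul_eq_div, le_div_iff₀ hγ]
      linarith
    have := harctan ζ hζ
    rw [neg_nonpos]
    positivity
  · refine ⟨-b / γ ^ 2 * (1 + γ / b ^ 2), fun ζ hζ => ?_⟩
    have hden : 0 < b ^ 2 + ζ ^ 2 := by positivity
    have hb_ne : b ≠ 0 := hb0.ne
    set s := Real.sqrt (a ^ 2 + ζ ^ 2) with hs
    have hs2 : s ^ 2 = a ^ 2 + ζ ^ 2 := Real.sq_sqrt (by positivity)
    have hs0 : 0 < s := Real.sqrt_pos.2 (by positivity)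
    have hlog : Real.log ((1 / γ) * s) ≤ (a ^ 2 + ζ ^ 2) / γ ^ 2 := by
      have h := Real.log_le_sub_one_of_pos (x := (1 / γ) * s) (by positivity)
      have h2 : ((1 / γ) * s) ^ 2 = (a ^ 2 + ζ ^ 2) / γ ^ 2 := by
        rw [mul_pow, hs2]; ring
      nlinarith [sq_nonneg ((1 / γ) * s - 1)]
    have hratio : a ^ 2 + ζ ^ 2 ≤ (1 + γ / b ^ 2) * (b ^ 2 + ζ ^ 2) := by
      have h : (1 + γ / b ^ 2) * (b ^ 2 + ζ ^ 2)
          = b ^ 2 + ζ ^ 2 + γ + γ / b ^ 2 * ζ ^ 2 := by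
        field_simp
        ring
      have : 0 ≤ γ / b ^ 2 * ζ ^ 2 := by positivity
      linarith
    rw [← neg_div, div_le_iff₀ hden]
    have hnb : 0 ≤ -b := by linarith
    calc -(b * Real.log ((1 / γ) * s) + ζ * Real.arctan (ζ / a))
        ≤ -b * Real.log ((1 / γ) * s) := by linarith [harctan ζ hζ]
      _ ≤ -b * ((a ^ 2 + ζ ^ 2) / γ ^ 2) := by gcongr
      _ = -b / γ ^ 2 * (a ^ 2 + ζ ^ 2) := by ring
      _ ≤ -b / γ ^ 2 * ((1 + γ / b ^ 2) * (b ^ 2 + ζ ^ 2)) := by gcongr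
      _ = -b / γ ^ 2 * (1 + γ / b ^ 2) * (b ^ 2 + ζ ^ 2) := by ring

/-- Zhu's early exercise boundary converges to the perpetual put option boundary
`γE/(1+γ)` as time to maturity tends to infinity. -/
theorem stmt_7 (E r σ : ℝ) (hE : 0 < E) (hr : 0 < r) (hσ : 0 < σ)
    (γ a b : ℝ) (hγ : γ = 2 * r / σ ^ 2) (ha : a = (1 + γ) / 2) (hb : b = (1 - γ) / 2)
    (f₁ f₂ : ℝ → ℝ)
    (hf₁ : ∀ ζ : ℝ, 0 < ζ →
      f₁ ζ = (b * Real.log ((1 / γ) * Real.sqrt (a ^ 2 + ζ ^ 2))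
        + ζ * Real.arctan (ζ / a)) / (b ^ 2 + ζ ^ 2))
    (hf₂ : ∀ ζ : ℝ, 0 < ζ →
      f₂ ζ = (ζ * Real.log ((1 / γ) * Real.sqrt (a ^ 2 + ζ ^ 2))
        - b * Real.arctan (ζ / a)) / (b ^ 2 + ζ ^ 2))
    (ϱ : ℝ → ℝ)
    (hϱ : ∀ τ : ℝ, 0 < τ →
      ϱ τ = γ * E / (1 + γ) + (2 * E / Real.pi) *
        ∫ ζ in Set.Ioi (0 : ℝ),
          (ζ * Real.exp (-τ * (σ ^ 2 / 2) * (a ^ 2 + ζ ^ 2)) / (a ^ 2 + ζ ^ 2))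
            * Real.exp (-(f₁ ζ)) * Real.sin (f₂ ζ)) :
    Filter.Tendsto ϱ Filter.atTop (nhds (γ * E / (1 + γ))) := by
  have hγ0 : 0 < γ := by rw [hγ]; positivity
  have ha0 : 0 < a := by rw [ha]; linarith
  obtain ⟨C, hC⟩ := exists_neg_zhuExponent_le hγ0 ha hb
  set k : ℝ := σ ^ 2 / 2 with hk
  have hk0 : 0 < k := by positivity
  let I : ℝ → ℝ := fun τ => ∫ ζ in Set.Ioi (0 : ℝ),
    (ζ * Real.exp (-τ * k * (a ^ 2 + ζ ^ 2)) / (a ^ 2 + ζ ^ 2))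
      * Real.exp (-(f₁ ζ)) * Real.sin (f₂ ζ)
  let M : ℝ := 1 / (2 * a) * Real.exp C
  let K : ℝ := ∫ ζ in Set.Ioi (0 : ℝ), M * Real.exp (-k * ζ ^ 2)
  have hbound : ∀ τ : ℝ, 1 ≤ τ → ‖I τ‖ ≤ Real.exp (-(τ * (k * a ^ 2))) * K := by
    intro τ hτ
    rw [← MeasureTheory.integral_const_mul]
    refine MeasureTheory.norm_integral_le_of_norm_le
      ((((integrable_exp_neg_mul_sq hk0).const_mul M).const_mul _).integrableOn) ?_
    filter_upwards [MeasureTheory.ae_restrict_mem measurableSet_Ioi] with ζ hζ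
    have hζ0 : 0 < ζ := hζ
    have hfrac : ζ / (a ^ 2 + ζ ^ 2) ≤ 1 / (2 * a) := by
      rw [div_le_div_iff₀ (by positivity) (by positivity)]
      nlinarith [sq_nonneg (a - ζ)]
    have hexp : Real.exp (-τ * k * (a ^ 2 + ζ ^ 2))
        ≤ Real.exp (-(τ * (k * a ^ 2))) * Real.exp (-k * ζ ^ 2) := by
      rw [← Real.exp_add]
      apply Real.exp_le_exp.2
      have : 0 ≤ (τ - 1) * (k * ζ ^ 2) := mul_nonneg (by linarith) (by positivity)
      nlinarith
    have hf : Real.exp (-(f₁ ζ)) ≤ Real.exp C := by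
      rw [hf₁ ζ hζ0]
      exact Real.exp_le_exp.2 (hC ζ hζ0)
    rw [norm_mul, Real.norm_of_nonneg (by positivity), Real.norm_eq_abs]
    calc ζ * Real.exp (-τ * k * (a ^ 2 + ζ ^ 2)) / (a ^ 2 + ζ ^ 2) * Real.exp (-(f₁ ζ))
          * |Real.sin (f₂ ζ)|
        ≤ ζ * Real.exp (-τ * k * (a ^ 2 + ζ ^ 2)) / (a ^ 2 + ζ ^ 2) * Real.exp (-(f₁ ζ)) :=
          mul_le_of_le_one_right (by positivity) (Real.abs_sin_le_one _)
      _ = ζ / (a ^ 2 + ζ ^ 2) * Real.exp (-τ * k * (a ^ 2 + ζ ^ 2)) * Real.exp (-(f₁ ζ)) := by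
          ring
      _ ≤ 1 / (2 * a) * (Real.exp (-(τ * (k * a ^ 2))) * Real.exp (-k * ζ ^ 2))
          * Real.exp C := by gcongr
      _ = Real.exp (-(τ * (k * a ^ 2))) * (M * Real.exp (-k * ζ ^ 2)) := by
          simp only [M]; ring
  have hdecay : Tendsto (fun τ : ℝ => Real.exp (-(τ * (k * a ^ 2))) * K) atTop (𝓝 0) := by
    have h : Tendsto (fun τ : ℝ => τ * (k * a ^ 2)) atTop atTop :=
      tendsto_id.atTop_mul_const (by positivity)
    simpa using (Real.tendsto_exp_neg_atTop_nhds_zero.comp h).mul_const K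
  have hI : Tendsto I atTop (𝓝 0) :=
    squeeze_zero_norm' ((eventually_ge_atTop 1).mono hbound) hdecay
  have hlim : Tendsto (fun τ => γ * E / (1 + γ) + (2 * E / Real.pi) * I τ) atTop
      (𝓝 (γ * E / (1 + γ))) := by
    simpa using (hI.const_mul (2 * E / Real.pi)).const_add (γ * E / (1 + γ))
  refine hlim.congr' ?_
  filter_upwards [eventually_gt_atTop 0] with τ hτ
  exact (hϱ τ hτ).symm
end

section
/- Let E, r, σ > 0, γ = 2r/σ², a = (1+γ)/2, b = (1-γ)/2, and let f₁*, f₂* be as in Zhu's formula. Then for every τ > 0 the function ϱ^{Zhu} is twice differentiable at τ and its second derivative equals (d²/dτ²)ϱ^{Zhu}(τ) = (Eσ⁴/(2π))·∫₀^∞ (a²+ζ²)·ζ·e^{-τ(σ²/2)(a²+ζ²)}·e^{-f₁*(ζ)}·sin(f₂*(ζ)) dζ (differentiation under the integral sign is valid). -/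
open MeasureTheory Real Filter Topology Set

lemma mul_exp_neg_mul_le {t x : ℝ} (ht : 0 < t) :
    x * Real.exp (-t * x) ≤ 1 / t := by
  have h : t * x ≤ Real.exp (t * x) := by linarith [Real.add_one_le_exp (t * x)]
  rw [le_div_iff₀ ht, neg_mul, Real.exp_neg]
  calc x * (Real.exp (t * x))⁻¹ * t = (t * x) / Real.exp (t * x) := by ring
    _ ≤ 1 := (div_le_one (Real.exp_pos _)).2 h

section LaplaceIntegral

variable {α : Type*} [MeasurableSpace α] {μ : Measure α} {q w : α → ℝ}

lemma integrable_exp_neg_mul_mul_self (hq : Measurable q) (hq0 : ∀ x, 0 ≤ q x)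
    (hw : ∀ t : ℝ, 0 < t → Integrable (fun x => Real.exp (-t * q x) * w x) μ)
    {t : ℝ} (ht : 0 < t) :
    Integrable (fun x => Real.exp (-t * q x) * (-(q x) * w x)) μ := by
  have ht2 : 0 < t / 2 := by positivity
  have h := (hw (t / 2) ht2).bdd_mul (c := 1 / (t / 2))
    (f := fun x => -(q x * Real.exp (-(t / 2) * q x)))
    (by fun_prop) (Eventually.of_forall fun x => by
      rw [norm_neg, Real.norm_of_nonneg (mul_nonneg (hq0 x) (Real.exp_pos _).le)]
      exact mul_exp_neg_mul_le ht2)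
  refine h.congr (Eventually.of_forall fun x => ?_)
  have : Real.exp (-t * q x) = Real.exp (-(t / 2) * q x) * Real.exp (-(t / 2) * q x) := by
    rw [← Real.exp_add]; ring_nf
  simp only [this]
  ring

lemma hasDerivAt_integral_exp_neg_mul_mul (hq : Measurable q) (hq0 : ∀ x, 0 ≤ q x)
    (hw : ∀ t : ℝ, 0 < t → Integrable (fun x => Real.exp (-t * q x) * w x) μ)
    {t : ℝ} (ht : 0 < t) :
    HasDerivAt (fun s => ∫ x, Real.exp (-s * q x) * w x ∂μ)
      (∫ x, Real.exp (-t * q x) * (-(q x) * w x) ∂μ) t := by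
  have ht2 : 0 < t / 2 := by positivity
  refine (hasDerivAt_integral_of_dominated_loc_of_deriv_le (𝕜 := ℝ)
    (F := fun s x => Real.exp (-s * q x) * w x)
    (F' := fun s x => Real.exp (-s * q x) * (-(q x) * w x))
    (bound := fun x => ‖Real.exp (-(t / 2) * q x) * (-(q x) * w x)‖)
    (Ioi_mem_nhds (half_lt_self ht)) ?_ (hw t ht)
    (integrable_exp_neg_mul_mul_self hq hq0 hw ht).aestronglyMeasurable ?_
    (integrable_exp_neg_mul_mul_self hq hq0 hw ht2).norm ?_).2
  · filter_upwards [Ioi_mem_nhds ht] with s hs using (hw s hs).aestronglyMeasurable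
  · refine Eventually.of_forall fun x s hs => ?_
    rw [norm_mul, norm_mul (Real.exp (-(t / 2) * q x)), Real.norm_of_nonneg (Real.exp_pos _).le,
      Real.norm_of_nonneg (Real.exp_pos _).le]
    gcongr
    · exact hq0 x
    · exact le_of_lt hs
  · refine Eventually.of_forall fun x s _ => ?_
    have h1 : HasDerivAt (fun s : ℝ => -s * q x) (-1 * q x) s :=
      (hasDerivAt_neg s).mul_const (q x)
    exact (h1.exp.mul_const (w x)).congr_deriv (by ring)

end LaplaceIntegral

lemma integrableOn_exp_neg_mul_add_sq_mul {p c K : ℝ} (hp : 0 < p) {w : ℝ → ℝ}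
    (hw : AEStronglyMeasurable w (volume.restrict (Ioi 0)))
    (hwK : ∀ x : ℝ, 0 < x → |w x| ≤ K * x) {t : ℝ} (ht : 0 < t) :
    Integrable (fun x => Real.exp (-t * (p * (c + x ^ 2))) * w x)
      (volume.restrict (Ioi 0)) := by
  have h : Integrable (fun x : ℝ => (Real.exp (-t * (p * c)) * K) *
      (x * Real.exp (-(t * p) * x ^ 2))) (volume.restrict (Ioi 0)) :=
    ((integrable_mul_exp_neg_mul_sq (mul_pos ht hp)).const_mul _).restrict
  have hm : AEStronglyMeasurable (fun x : ℝ => Real.exp (-t * (p * (c + x ^ 2))))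
      (volume.restrict (Ioi 0)) := by fun_prop
  refine h.mono' (hm.mul hw) ?_
  filter_upwards [ae_restrict_mem measurableSet_Ioi] with x hx
  rw [norm_mul, Real.norm_of_nonneg (Real.exp_pos _).le, Real.norm_eq_abs]
  calc Real.exp (-t * (p * (c + x ^ 2))) * |w x|
      ≤ Real.exp (-t * (p * (c + x ^ 2))) * (K * x) := by
        gcongr
        exact hwK x hx
    _ = _ := by
        rw [show -t * (p * (c + x ^ 2)) = -t * (p * c) + -(t * p) * x ^ 2 by ring, Real.exp_add]
        ring

/-- The exponent `f₁*` in Zhu's formula is bounded below on the positive half-line. -/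
lemma exists_lower_bound_zhu_exponent {γ a b : ℝ} (hγ : 0 < γ) (ha : a = (1 + γ) / 2)
    (hb : b = (1 - γ) / 2) :
    ∃ C : ℝ, ∀ x : ℝ, 0 < x →
      C ≤ (b * Real.log ((1 / γ) * Real.sqrt (a ^ 2 + x ^ 2))
        + x * Real.arctan (x / a)) / (b ^ 2 + x ^ 2) := by
  have ha0 : 0 < a := by rw [ha]; positivity
  have harc : ∀ x : ℝ, 0 < x → 0 ≤ x * Real.arctan (x / a) := fun x hx =>
    mul_nonneg hx.le (Real.arctan_nonneg.2 (by positivity))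
  rcases le_or_gt 0 b with hb0 | hb0
  · refine ⟨0, fun x hx => div_nonneg (add_nonneg (mul_nonneg hb0 (Real.log_nonneg ?_))
      (harc x hx)) (by positivity)⟩
    rw [one_div_mul_eq_div, le_div_iff₀ hγ, one_mul]
    exact Real.le_sqrt_of_sq_le (by nlinarith)
  · have hbne : b ≠ 0 := hb0.ne
    refine ⟨b / γ * (1 + (1 + a ^ 2) / b ^ 2), fun x hx => ?_⟩
    have hbsq : 0 < b ^ 2 := by positivity
    rw [le_div_iff₀ (by positivity)]
    have hs : 0 < a ^ 2 + x ^ 2 := by positivity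
    have hsqrt : Real.sqrt (a ^ 2 + x ^ 2) ≤ 1 + a ^ 2 + x ^ 2 :=
      Real.sqrt_le_iff.2 ⟨by positivity, by nlinarith⟩
    have hlog : Real.log ((1 / γ) * Real.sqrt (a ^ 2 + x ^ 2)) ≤
        (1 / γ) * Real.sqrt (a ^ 2 + x ^ 2) := Real.log_le_self (by positivity)
    have hK : 1 + a ^ 2 + x ^ 2 ≤ (1 + (1 + a ^ 2) / b ^ 2) * (b ^ 2 + x ^ 2) := by
      have : (1 + (1 + a ^ 2) / b ^ 2) * (b ^ 2 + x ^ 2) =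
          (1 + a ^ 2 + x ^ 2) + (b ^ 2 + (1 + a ^ 2) / b ^ 2 * x ^ 2) := by
        field_simp
        ring
      rw [this]
      exact le_add_of_nonneg_right (by positivity)
    have hle : Real.log ((1 / γ) * Real.sqrt (a ^ 2 + x ^ 2)) ≤
        (1 / γ) * ((1 + (1 + a ^ 2) / b ^ 2) * (b ^ 2 + x ^ 2)) :=
      hlog.trans (by gcongr; exact hsqrt.trans hK)
    calc b / γ * (1 + (1 + a ^ 2) / b ^ 2) * (b ^ 2 + x ^ 2)
        = b * ((1 / γ) * ((1 + (1 + a ^ 2) / b ^ 2) * (b ^ 2 + x ^ 2))) := by ring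
      _ ≤ b * Real.log ((1 / γ) * Real.sqrt (a ^ 2 + x ^ 2)) :=
        mul_le_mul_of_nonpos_left hle hb0.le
      _ ≤ _ := le_add_of_nonneg_right (harc x hx)

/-- For every `τ > 0`, Zhu's boundary function `ϱ^{Zhu}` is twice differentiable at `τ`
and its second derivative equals
`(Eσ⁴/(2π))·∫₀^∞ (a²+ζ²)·ζ·e^{-τ(σ²/2)(a²+ζ²)}·e^{-f₁*(ζ)}·sin(f₂*(ζ)) dζ`. -/
theorem stmt_8 (E r σ : ℝ) (hE : 0 < E) (hr : 0 < r) (hσ : 0 < σ)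
    (γ a b : ℝ) (hγ : γ = 2 * r / σ ^ 2) (ha : a = (1 + γ) / 2) (hb : b = (1 - γ) / 2)
    (f₁ f₂ : ℝ → ℝ)
    (hf₁ : ∀ ζ : ℝ, 0 < ζ →
      f₁ ζ = (b * Real.log ((1 / γ) * Real.sqrt (a ^ 2 + ζ ^ 2))
        + ζ * Real.arctan (ζ / a)) / (b ^ 2 + ζ ^ 2))
    (hf₂ : ∀ ζ : ℝ, 0 < ζ →
      f₂ ζ = (ζ * Real.log ((1 / γ) * Real.sqrt (a ^ 2 + ζ ^ 2))
        - b * Real.arctan (ζ / a)) / (b ^ 2 + ζ ^ 2))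
    (ϱ : ℝ → ℝ)
    (hϱ : ∀ τ : ℝ, 0 < τ →
      ϱ τ = γ * E / (1 + γ) + (2 * E / Real.pi) *
        ∫ ζ in Set.Ioi (0 : ℝ),
          (ζ * Real.exp (-τ * (σ ^ 2 / 2) * (a ^ 2 + ζ ^ 2)) / (a ^ 2 + ζ ^ 2))
            * Real.exp (-(f₁ ζ)) * Real.sin (f₂ ζ)) :
    ∀ τ : ℝ, 0 < τ →
      DifferentiableAt ℝ ϱ τ ∧ DifferentiableAt ℝ (deriv ϱ) τ ∧
      deriv (deriv ϱ) τ = (E * σ ^ 4 / (2 * Real.pi)) *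
        ∫ ζ in Set.Ioi (0 : ℝ),
          (a ^ 2 + ζ ^ 2) * ζ * Real.exp (-τ * (σ ^ 2 / 2) * (a ^ 2 + ζ ^ 2))
            * Real.exp (-(f₁ ζ)) * Real.sin (f₂ ζ) := by
  have hγ0 : 0 < γ := by rw [hγ]; positivity
  have ha0 : 0 < a := by rw [ha]; positivity
  obtain ⟨C, hC⟩ := exists_lower_bound_zhu_exponent hγ0 ha hb
  set p : ℝ := σ ^ 2 / 2 with hp
  have hp0 : 0 < p := by positivity
  set g : ℝ → ℝ := fun ζ => Real.exp (-(f₁ ζ)) * Real.sin (f₂ ζ) with hg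
  have hgm : AEStronglyMeasurable g (volume.restrict (Ioi 0)) := by
    have hm : Measurable fun ζ : ℝ =>
        Real.exp (-((b * Real.log ((1 / γ) * Real.sqrt (a ^ 2 + ζ ^ 2))
          + ζ * Real.arctan (ζ / a)) / (b ^ 2 + ζ ^ 2))) *
        Real.sin ((ζ * Real.log ((1 / γ) * Real.sqrt (a ^ 2 + ζ ^ 2))
          - b * Real.arctan (ζ / a)) / (b ^ 2 + ζ ^ 2)) := by fun_prop
    refine hm.aestronglyMeasurable.congr ?_
    filter_upwards [ae_restrict_mem measurableSet_Ioi] with ζ hζ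
    simp only [hg, hf₁ ζ hζ, hf₂ ζ hζ]
  have hgb : ∀ ζ : ℝ, 0 < ζ → |g ζ| ≤ Real.exp (-C) := fun ζ hζ => by
    rw [hg, abs_mul, Real.abs_exp]
    have h1 : Real.exp (-(f₁ ζ)) ≤ Real.exp (-C) :=
      Real.exp_le_exp.2 (neg_le_neg ((hC ζ hζ).trans_eq (hf₁ ζ hζ).symm))
    simpa using mul_le_mul h1 (Real.abs_sin_le_one (f₂ ζ)) (abs_nonneg _) (Real.exp_pos _).le
  set q : ℝ → ℝ := fun ζ => p * (a ^ 2 + ζ ^ 2) with hq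
  have hqm : Measurable q := by fun_prop
  have hq0 : ∀ ζ, 0 ≤ q ζ := fun ζ => by positivity
  set w : ℝ → ℝ := fun ζ => ζ / (a ^ 2 + ζ ^ 2) * g ζ with hw
  have hwint : ∀ t : ℝ, 0 < t →
      Integrable (fun ζ => Real.exp (-t * q ζ) * w ζ) (volume.restrict (Ioi 0)) := by
    have hm : Measurable fun ζ : ℝ => ζ / (a ^ 2 + ζ ^ 2) := by fun_prop
    refine fun t ht => integrableOn_exp_neg_mul_add_sq_mul (K := Real.exp (-C) / a ^ 2) hp0
      (hm.aestronglyMeasurable.mul hgm) (fun ζ hζ => ?_) ht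
    change |ζ / (a ^ 2 + ζ ^ 2) * g ζ| ≤ _
    rw [abs_mul, abs_of_pos (by positivity : 0 < ζ / (a ^ 2 + ζ ^ 2))]
    calc ζ / (a ^ 2 + ζ ^ 2) * |g ζ| ≤ ζ / a ^ 2 * Real.exp (-C) := by
          gcongr
          · exact le_add_of_nonneg_right (sq_nonneg ζ)
          · exact hgb ζ hζ
      _ = Real.exp (-C) / a ^ 2 * ζ := by ring
  have hwint' : ∀ t : ℝ, 0 < t →
      Integrable (fun ζ => Real.exp (-t * q ζ) * (-(q ζ) * w ζ)) (volume.restrict (Ioi 0)) :=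
    fun t ht => integrable_exp_neg_mul_mul_self hqm hq0 hwint ht
  have hϱ' : ∀ τ : ℝ, 0 < τ → HasDerivAt ϱ ((2 * E / Real.pi) *
      ∫ ζ in Ioi (0 : ℝ), Real.exp (-τ * q ζ) * (-(q ζ) * w ζ)) τ := fun τ hτ => by
    refine (((hasDerivAt_integral_exp_neg_mul_mul hqm hq0 hwint hτ).const_mul
      (2 * E / Real.pi)).const_add (γ * E / (1 + γ))).congr_of_eventuallyEq ?_
    filter_upwards [Ioi_mem_nhds hτ] with s hs
    rw [hϱ s hs]
    congr 3
    funext ζ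
    simp only [hq, hw, hg, mul_assoc]
    ring
  intro τ hτ
  have hϱ'' : HasDerivAt (deriv ϱ) ((2 * E / Real.pi) *
      ∫ ζ in Ioi (0 : ℝ), Real.exp (-τ * q ζ) * (-(q ζ) * (-(q ζ) * w ζ))) τ := by
    refine ((hasDerivAt_integral_exp_neg_mul_mul hqm hq0 hwint' hτ).const_mul
      (2 * E / Real.pi)).congr_of_eventuallyEq ?_
    filter_upwards [Ioi_mem_nhds hτ] with s hs using (hϱ' s hs).deriv
  refine ⟨(hϱ' τ hτ).differentiableAt, hϱ''.differentiableAt, ?_⟩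
  rw [hϱ''.deriv, ← integral_const_mul, ← integral_const_mul]
  congr 1
  funext ζ
  have hne : a ^ 2 + ζ ^ 2 ≠ 0 := by positivity
  simp only [hq, hw, hg, hp, ← mul_assoc]
  field_simp
end

section
/- Let E, r, σ > 0, γ = 2r/σ², a = (1+γ)/2, b = (1-γ)/2, and let f₁*, f₂* be as in Zhu's formula. Assume that 0 ≤ f₂*(ζ) ≤ π for all ζ > 0. Then (d²/dτ²)ϱ^{Zhu}(τ) > 0 for every τ > 0; in particular, the function τ ↦ ϱ^{Zhu}(τ) is strictly convex on (0, ∞). -/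
open MeasureTheory Real Filter Topology Set

namespace ZhuBoundary

open ProbabilityTheory

/-- The second derivative of the moment-generating function of an a.e. nonzero variable is
positive in the interior of its domain. -/
lemma deriv_deriv_mgf_pos {Ω : Type*} [MeasurableSpace Ω] {μ : Measure Ω} (hμ : μ ≠ 0)
    {X : Ω → ℝ} (hX : ∀ ω, X ω ≠ 0) {t : ℝ} (ht : t ∈ interior (integrableExpSet X μ)) :
    0 < deriv (deriv (mgf X μ)) t := by
  have h := iteratedDeriv_mgf ht 2
  rw [iteratedDeriv_eq_iterate] at h
  change deriv (deriv (mgf X μ)) t = _ at h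
  rw [h, integral_pos_iff_support_of_nonneg (fun ω => by positivity)
    (integrable_pow_mul_exp_of_mem_interior_integrableExpSet ht 2)]
  have hs : Function.support (fun ω => X ω ^ 2 * exp (t * X ω)) = univ := by
    ext ω
    simp [hX ω]
  rw [hs]
  exact (Measure.measure_univ_pos).2 hμ

/-- A Gaussian-type Laplace transform of a nonnegative bounded density that does not vanish near
infinity has a positive second derivative. -/
lemma differentiableAt_and_deriv2_pos_integral_mul_exp {g : ℝ → ℝ} (hgm : Measurable g) {C c a : ℝ}
    (hc : 0 < c) (ha : a ≠ 0) (hg0 : ∀ ζ, 0 < ζ → 0 ≤ g ζ) (hgC : ∀ ζ, 0 < ζ → g ζ ≤ C)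
    (hgpos : ∀ᶠ ζ in atTop, 0 < g ζ) {τ : ℝ} (hτ : 0 < τ) :
    DifferentiableAt ℝ
        (fun τ => ∫ ζ in Ioi (0 : ℝ), g ζ * exp (-τ * c * (a ^ 2 + ζ ^ 2))) τ ∧
      0 < deriv (deriv
        (fun τ => ∫ ζ in Ioi (0 : ℝ), g ζ * exp (-τ * c * (a ^ 2 + ζ ^ 2)))) τ := by
  set ν : Measure ℝ := volume.restrict (Ioi 0) with hν
  set μ : Measure ℝ := ν.withDensity (fun ζ => ENNReal.ofReal (g ζ)) with hμ
  set X : ℝ → ℝ := fun ζ => -(c * (a ^ 2 + ζ ^ 2)) with hX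
  have hX0 : ∀ ζ, X ζ ≠ 0 := fun ζ => by
    have : 0 < c * (a ^ 2 + ζ ^ 2) := by positivity
    exact (neg_neg_of_pos this).ne
  have hfun : (fun τ => ∫ ζ in Ioi (0 : ℝ), g ζ * exp (-τ * c * (a ^ 2 + ζ ^ 2))) = mgf X μ := by
    funext t
    rw [mgf, hμ, integral_withDensity_eq_integral_toReal_smul hgm.ennreal_ofReal (by simp)]
    refine setIntegral_congr_fun measurableSet_Ioi fun ζ hζ => ?_
    simp only [ENNReal.toReal_ofReal (hg0 ζ hζ), smul_eq_mul, hX]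
    ring_nf
  have hsub : Ioi (0 : ℝ) ⊆ integrableExpSet X μ := by
    intro t (ht : 0 < t)
    change Integrable _ _
    rw [hμ, integrable_withDensity_iff_integrable_smul' hgm.ennreal_ofReal (by simp)]
    refine Integrable.mono'
      (((integrable_exp_neg_mul_sq (mul_pos ht hc)).const_mul C).integrableOn (s := Ioi 0))
      (by fun_prop) ?_
    filter_upwards [ae_restrict_mem measurableSet_Ioi] with ζ hζ
    rw [ENNReal.toReal_ofReal (hg0 ζ hζ), smul_eq_mul,
      norm_of_nonneg (mul_nonneg (hg0 ζ hζ) (exp_pos _).le)]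
    refine mul_le_mul (hgC ζ hζ) (exp_le_exp.2 ?_) (exp_pos _).le ((hg0 ζ hζ).trans (hgC ζ hζ))
    have : 0 ≤ t * c * a ^ 2 := by positivity
    simp only [hX]
    linarith
  have hint : τ ∈ interior (integrableExpSet X μ) :=
    interior_maximal hsub isOpen_Ioi hτ
  have hμ0 : μ ≠ 0 := by
    rw [hμ, Ne, withDensity_eq_zero_iff hgm.ennreal_ofReal.aemeasurable]
    intro h
    obtain ⟨R, hR⟩ := eventually_atTop.1 hgpos
    rw [hν, EventuallyEq, ae_restrict_iff' measurableSet_Ioi] at h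
    have hnull : volume (Ioi (max R 0)) = 0 := by
      refine measure_mono_null (fun ζ hζ => ?_) (ae_iff.1 h)
      have hζ' : R < ζ ∧ 0 < ζ := by simpa using hζ
      simpa [hζ'.2] using hR ζ hζ'.1.le
    simp at hnull
  rw [hfun]
  exact ⟨differentiableAt_mgf hint, deriv_deriv_mgf_pos hμ0 hX0 hint⟩

/-- Zhu's function `f₁*`. -/
noncomputable def zhuF₁ (γ a b ζ : ℝ) : ℝ :=
  (b * log ((1 / γ) * √(a ^ 2 + ζ ^ 2)) + ζ * arctan (ζ / a)) / (b ^ 2 + ζ ^ 2)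

/-- Zhu's function `f₂*`. -/
noncomputable def zhuF₂ (γ a b ζ : ℝ) : ℝ :=
  (ζ * log ((1 / γ) * √(a ^ 2 + ζ ^ 2)) - b * arctan (ζ / a)) / (b ^ 2 + ζ ^ 2)

lemma abs_log_le_add_inv {y : ℝ} (hy : 0 < y) : |log y| ≤ y + y⁻¹ := by
  have h₁ := log_le_sub_one_of_pos hy
  have h₂ := one_sub_inv_le_log_of_pos hy
  have h₃ := inv_pos.2 hy
  rw [abs_le]
  constructor <;> linarith

lemma exists_neg_zhuF₁_le {γ a : ℝ} (hγ : 0 < γ) (ha : 0 < a) (b : ℝ) :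
    ∃ K, ∀ ζ, 0 < ζ → -zhuF₁ γ a b ζ ≤ K := by
  by_cases hb : b = 0
  · refine ⟨0, fun ζ hζ => ?_⟩
    have := arctan_nonneg.2 (div_pos hζ ha).le
    simp only [zhuF₁, hb, zero_mul, zero_add, Left.neg_nonpos_iff]
    positivity
  have hb2 : 0 < b ^ 2 := by positivity
  set B := (1 + a ^ 2) / γ + γ / a with hB
  have hBpos : 0 < B := by positivity
  refine ⟨|b| * (B / b ^ 2 + 1 / γ), fun ζ hζ => ?_⟩
  set s := √(a ^ 2 + ζ ^ 2) with hs
  have hs2 : s ^ 2 = a ^ 2 + ζ ^ 2 := sq_sqrt (by positivity)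
  have has : a ≤ s := le_sqrt_of_sq_le (by nlinarith)
  have hspos : 0 < s := ha.trans_le has
  have hlog : |log ((1 / γ) * s)| ≤ B + ζ ^ 2 / γ := by
    refine (abs_log_le_add_inv (by positivity)).trans ?_
    have h₁ : 1 / γ * s ≤ (1 + a ^ 2) / γ + ζ ^ 2 / γ := by
      rw [one_div_mul_eq_div, ← add_div]
      exact div_le_div_of_nonneg_right (by nlinarith) hγ.le
    have h₂ : (1 / γ * s)⁻¹ ≤ γ / a := by
      rw [one_div_mul_eq_div, inv_div]
      exact div_le_div_of_nonneg_left hγ.le ha has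
    linarith
  have harc : 0 ≤ ζ * arctan (ζ / a) :=
    mul_nonneg hζ.le (arctan_nonneg.2 (div_pos hζ ha).le)
  rw [zhuF₁, ← neg_div, div_le_iff₀ (by positivity)]
  have hnum : -(b * log ((1 / γ) * s)) ≤ |b| * (B + ζ ^ 2 / γ) :=
    (neg_le_abs _).trans (by rw [abs_mul]; gcongr)
  have hmul : B + ζ ^ 2 / γ ≤ (B / b ^ 2 + 1 / γ) * (b ^ 2 + ζ ^ 2) := by
    have h₁ : (B / b ^ 2 + 1 / γ) * (b ^ 2 + ζ ^ 2)
        = B + ζ ^ 2 / γ + (B / b ^ 2 * ζ ^ 2 + b ^ 2 / γ) := by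
      field_simp
      ring
    have h₂ : 0 ≤ B / b ^ 2 * ζ ^ 2 + b ^ 2 / γ := by positivity
    linarith
  have := mul_le_mul_of_nonneg_left hmul (abs_nonneg b)
  linarith

lemma eventually_zhuF₂_mem_Ioo {γ : ℝ} (hγ : 0 < γ) (a b : ℝ) :
    ∀ᶠ ζ in atTop, zhuF₂ γ a b ζ ∈ Ioo 0 π := by
  have hu : Tendsto (fun ζ : ℝ => 2 / γ * ζ) atTop atTop :=
    tendsto_id.const_mul_atTop (by positivity)
  have hsmall := hu.eventually (isLittleO_log_id_atTop.bound (show (0 : ℝ) < γ / 2 by positivity))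
  filter_upwards [hsmall, eventually_ge_atTop (|a|), eventually_ge_atTop (γ * exp 1),
    eventually_gt_atTop (|b| * 2), eventually_gt_atTop 1] with ζ hlog haζ hγζ hbζ hζ₁
  have hζ : 0 < ζ := one_pos.trans hζ₁
  set s := √(a ^ 2 + ζ ^ 2) with hs
  have hs2 : s ^ 2 = a ^ 2 + ζ ^ 2 := sq_sqrt (by positivity)
  have hζs : ζ ≤ s := le_sqrt_of_sq_le (by nlinarith [sq_nonneg a])
  have ha2 : a ^ 2 ≤ ζ ^ 2 := sq_le_sq.2 (by rwa [abs_of_pos hζ])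
  have hs' : s ≤ 2 * ζ := sqrt_le_iff.2 ⟨by positivity, by nlinarith⟩
  have hlow : 1 ≤ log (1 / γ * s) := by
    rw [le_log_iff_exp_le (by positivity), one_div_mul_eq_div, le_div_iff₀ hγ]
    linarith
  have hup : log (1 / γ * s) ≤ ζ := by
    have h₁ : log (1 / γ * s) ≤ log (2 / γ * ζ) := by
      refine log_le_log (by positivity) ?_
      rw [one_div_mul_eq_div, div_mul_eq_mul_div]
      gcongr
    have h₂ : γ / 2 * ‖2 / γ * ζ‖ = ζ := by
      rw [norm_of_nonneg (by positivity)]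
      field_simp
    simp only [id] at hlog
    rw [h₂] at hlog
    exact h₁.trans ((le_norm_self _).trans hlog)
  have harc : |b * arctan (ζ / a)| ≤ |b| * 2 := by
    rw [abs_mul]
    gcongr
    rw [abs_le]
    have := arctan_lt_pi_div_two (ζ / a)
    have := neg_pi_div_two_lt_arctan (ζ / a)
    have := pi_lt_four
    constructor <;> linarith
  obtain ⟨harc₁, harc₂⟩ := abs_le.1 harc
  constructor
  · rw [zhuF₂]
    refine div_pos ?_ (by positivity)
    nlinarith
  · rw [zhuF₂, div_lt_iff₀ (by positivity)]
    have := mul_le_mul_of_nonneg_left hup hζ.le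
    have := mul_le_mul_of_nonneg_right pi_gt_three.le (show 0 ≤ b ^ 2 + ζ ^ 2 by positivity)
    nlinarith [sq_nonneg b]

end ZhuBoundary

/-- If `0 ≤ f₂*(ζ) ≤ π` for all `ζ > 0`, then the second derivative of Zhu's boundary
function is positive on `(0,∞)`; in particular `ϱ^{Zhu}` is strictly convex on `(0,∞)`. -/
theorem stmt_9 (E r σ : ℝ) (hE : 0 < E) (hr : 0 < r) (hσ : 0 < σ)
    (γ a b : ℝ) (hγ : γ = 2 * r / σ ^ 2) (ha : a = (1 + γ) / 2) (hb : b = (1 - γ) / 2)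
    (f₁ f₂ : ℝ → ℝ)
    (hf₁ : ∀ ζ : ℝ, 0 < ζ →
      f₁ ζ = (b * Real.log ((1 / γ) * Real.sqrt (a ^ 2 + ζ ^ 2))
        + ζ * Real.arctan (ζ / a)) / (b ^ 2 + ζ ^ 2))
    (hf₂ : ∀ ζ : ℝ, 0 < ζ →
      f₂ ζ = (ζ * Real.log ((1 / γ) * Real.sqrt (a ^ 2 + ζ ^ 2))
        - b * Real.arctan (ζ / a)) / (b ^ 2 + ζ ^ 2))
    (hbound : ∀ ζ : ℝ, 0 < ζ → 0 ≤ f₂ ζ ∧ f₂ ζ ≤ Real.pi)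
    (ϱ : ℝ → ℝ)
    (hϱ : ∀ τ : ℝ, 0 < τ →
      ϱ τ = γ * E / (1 + γ) + (2 * E / Real.pi) *
        ∫ ζ in Set.Ioi (0 : ℝ),
          (ζ * Real.exp (-τ * (σ ^ 2 / 2) * (a ^ 2 + ζ ^ 2)) / (a ^ 2 + ζ ^ 2))
            * Real.exp (-(f₁ ζ)) * Real.sin (f₂ ζ)) :
    (∀ τ : ℝ, 0 < τ → 0 < deriv (deriv ϱ) τ) ∧
    StrictConvexOn ℝ (Set.Ioi 0) ϱ := by
  have hγ0 : 0 < γ := by rw [hγ]; positivity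
  have ha0 : 0 < a := by rw [ha]; positivity
  have hc : 0 < σ ^ 2 / 2 := by positivity
  set g : ℝ → ℝ := fun ζ => ζ / (a ^ 2 + ζ ^ 2) * exp (-ZhuBoundary.zhuF₁ γ a b ζ)
    * sin (ZhuBoundary.zhuF₂ γ a b ζ) with hg
  have hgm : Measurable g := by
    unfold g ZhuBoundary.zhuF₁ ZhuBoundary.zhuF₂
    fun_prop
  have hsin : ∀ ζ, 0 < ζ → 0 ≤ sin (ZhuBoundary.zhuF₂ γ a b ζ) := fun ζ hζ => by
    have h := hbound ζ hζ
    rw [hf₂ ζ hζ] at h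
    exact sin_nonneg_of_nonneg_of_le_pi h.1 h.2
  have hg0 : ∀ ζ, 0 < ζ → 0 ≤ g ζ := fun ζ hζ => by
    have := hsin ζ hζ
    simp only [hg]
    positivity
  obtain ⟨K, hK⟩ := ZhuBoundary.exists_neg_zhuF₁_le hγ0 ha0 b
  have hgC : ∀ ζ, 0 < ζ → g ζ ≤ 1 / a * exp K * 1 := fun ζ hζ => by
    have hfrac : ζ / (a ^ 2 + ζ ^ 2) ≤ 1 / a := by
      rw [div_le_div_iff₀ (by positivity) ha0]
      nlinarith [sq_nonneg (a - ζ), mul_pos ha0 hζ]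
    have := hsin ζ hζ
    simp only [hg]
    gcongr
    · exact hK ζ hζ
    · exact sin_le_one _
  have hgpos : ∀ᶠ ζ in atTop, 0 < g ζ := by
    filter_upwards [ZhuBoundary.eventually_zhuF₂_mem_Ioo hγ0 a b, eventually_gt_atTop 0]
      with ζ hζ hζ0
    have := sin_pos_of_mem_Ioo hζ
    simp only [hg]
    positivity
  set I : ℝ → ℝ := fun τ =>
    ∫ ζ in Ioi (0 : ℝ), g ζ * exp (-τ * (σ ^ 2 / 2) * (a ^ 2 + ζ ^ 2)) with hI
  have hmain : ∀ τ, 0 < τ → DifferentiableAt ℝ I τ ∧ 0 < deriv (deriv I) τ := fun τ hτ =>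
    ZhuBoundary.differentiableAt_and_deriv2_pos_integral_mul_exp hgm hc ha0.ne' hg0 hgC hgpos hτ
  have hϱI : EqOn ϱ (fun τ => γ * E / (1 + γ) + (2 * E / π) * I τ) (Ioi 0) := by
    intro τ hτ
    simp only [hϱ τ hτ, hI]
    congr 2
    refine setIntegral_congr_fun measurableSet_Ioi fun ζ hζ => ?_
    simp only [hg, ZhuBoundary.zhuF₁, ZhuBoundary.zhuF₂, hf₁ ζ hζ, hf₂ ζ hζ]
    ring
  have hderiv : EqOn (deriv ϱ) (fun τ => (2 * E / π) * deriv I τ) (Ioi 0) := by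
    intro τ hτ
    rw [(hϱI.eventuallyEq_of_mem (Ioi_mem_nhds hτ)).deriv_eq]
    simp
  have hpos : ∀ τ : ℝ, 0 < τ → 0 < deriv (deriv ϱ) τ := by
    intro τ hτ
    rw [(hderiv.eventuallyEq_of_mem (Ioi_mem_nhds hτ)).deriv_eq, deriv_const_mul_field]
    have := (hmain τ hτ).2
    positivity
  refine ⟨hpos, strictConvexOn_of_deriv2_pos' (convex_Ioi 0) ?_ hpos⟩
  refine ContinuousOn.congr (fun τ hτ => ?_) hϱI
  have := (hmain τ hτ).1.continuousAt
  exact ContinuousAt.continuousWithinAt (by fun_prop)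
end

section
/- Let E, r, σ > 0 and define ϱ^{SSC}(τ) = E·exp(-(r - σ²/2)τ - σ√(2τ)·√(-ln[(2r/σ)·√(2πτ)·e^{rτ}])) for all sufficiently small τ > 0 (i.e. those τ for which (2r/σ)·√(2πτ)·e^{rτ} < 1). Then lim_{τ→0⁺} (E - ϱ^{SSC}(τ)) / (√τ·√(-ln τ)) = Eσ; equivalently, ϱ^{SSC}(τ) = E·(1 - σ·√τ·√(-ln τ)) + o(√τ·√(-ln τ)) as τ → 0⁺. -/
open MeasureTheory Real Filter Topology Set

/-- First-order expansion of `exp` along a filter: if `g → 0` and `X / g → c` then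
`(1 - exp X) / g → -c`. -/
theorem tendsto_one_sub_exp_div {α : Type*} {l : Filter α} {X g : α → ℝ} {c : ℝ}
    (hg0 : ∀ᶠ a in l, g a ≠ 0) (hg : Tendsto g l (𝓝 0))
    (hX : Tendsto (fun a => X a / g a) l (𝓝 c)) :
    Tendsto (fun a => (1 - Real.exp (X a)) / g a) l (𝓝 (-c)) := by
  have hX0 : Tendsto X l (𝓝 0) := by
    have h := hX.mul hg
    rw [mul_zero] at h
    refine h.congr' ?_
    filter_upwards [hg0] with a ha
    field_simp
  have hD : Tendsto (dslope Real.exp 0) (𝓝 0) (𝓝 1) := by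
    have h : ContinuousAt (dslope Real.exp 0) 0 :=
      continuousAt_dslope_same.2 Real.differentiableAt_exp
    simpa [ContinuousAt, dslope_same] using h
  have h := ((hD.comp hX0).mul hX).neg
  rw [one_mul] at h
  refine h.congr fun a => ?_
  have e : X a * dslope Real.exp 0 (X a) = Real.exp (X a) - 1 := by
    simpa using sub_smul_dslope Real.exp 0 (X a)
  have e' : 1 - Real.exp (X a) = -(X a * dslope Real.exp 0 (X a)) := by rw [e]; ring
  simp only [Function.comp_apply]
  rw [e']
  ring

theorem tendsto_sqrt_mul_sqrt_neg_log :
    Tendsto (fun τ : ℝ => Real.sqrt τ * Real.sqrt (-Real.log τ)) (𝓝[>] 0) (𝓝 0) := by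
  have h : Tendsto (fun τ : ℝ => Real.sqrt (-(τ * Real.log τ))) (𝓝[>] 0) (𝓝 0) := by
    have hc : Continuous fun τ : ℝ => Real.sqrt (-(τ * Real.log τ)) :=
      Real.continuous_sqrt.comp Real.continuous_mul_log.neg
    simpa using (hc.tendsto 0).mono_left nhdsWithin_le_nhds
  refine h.congr' ?_
  filter_upwards [self_mem_nhdsWithin] with τ hτ
  rw [← Real.sqrt_mul (le_of_lt hτ), mul_neg]

theorem neg_log_mul_sqrt_mul_exp {a b r τ : ℝ} (ha : 0 < a) (hb : 0 < b) (hτ : 0 < τ) :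
    -Real.log (a * Real.sqrt (b * τ) * Real.exp (r * τ)) =
      -Real.log τ / 2 - (Real.log a + Real.log b / 2) - r * τ := by
  have hs : 0 < Real.sqrt (b * τ) := Real.sqrt_pos.2 (mul_pos hb hτ)
  rw [Real.log_mul (mul_pos ha hs).ne' (Real.exp_pos _).ne', Real.log_mul ha.ne' hs.ne',
    Real.log_exp, Real.log_sqrt (mul_pos hb hτ).le, Real.log_mul hb.ne' hτ.ne']
  ring

theorem tendsto_sqrt_neg_log_mul_sqrt_mul_exp {a b : ℝ} (r : ℝ) (ha : 0 < a) (hb : 0 < b) :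
    Tendsto (fun τ : ℝ =>
      Real.sqrt (-Real.log (a * Real.sqrt (b * τ) * Real.exp (r * τ))) /
        Real.sqrt (-Real.log τ)) (𝓝[>] 0) (𝓝 (Real.sqrt (1 / 2))) := by
  have hL : Tendsto (fun τ : ℝ => (-Real.log τ)⁻¹) (𝓝[>] 0) (𝓝 0) :=
    (tendsto_neg_atBot_atTop.comp Real.tendsto_log_nhdsGT_zero).inv_tendsto_atTop
  have hid : Tendsto (fun τ : ℝ => τ) (𝓝[>] 0) (𝓝 0) := nhdsWithin_le_nhds
  have h : Tendsto (fun τ : ℝ => 1 / 2 - (Real.log a + Real.log b / 2) * (-Real.log τ)⁻¹ -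
      r * τ * (-Real.log τ)⁻¹) (𝓝[>] 0) (𝓝 (1 / 2)) := by
    simpa using (tendsto_const_nhds.sub (hL.const_mul _)).sub ((hid.const_mul r).mul hL)
  refine h.sqrt.congr' ?_
  filter_upwards [Ioo_mem_nhdsGT (zero_lt_one' ℝ)] with τ hτ
  have hlog : 0 < -Real.log τ := neg_pos.2 (Real.log_neg hτ.1 hτ.2)
  rw [← Real.sqrt_div' _ hlog.le, neg_log_mul_sqrt_mul_exp ha hb hτ.1]
  congr 1
  generalize -Real.log τ = L at hlog ⊢
  field_simp

/-- Close-to-expiry asymptotics of the Stamicar–Ševčovič–Chadam approximation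
`ϱ^{SSC}(τ) = E·exp(-(r-σ²/2)τ - σ√(2τ)·√(-ln[(2r/σ)√(2πτ)e^{rτ}]))`:
`lim_{τ→0⁺} (E - ϱ^{SSC}(τ))/(√τ·√(-ln τ)) = Eσ`. -/
theorem stmt_10 (E r σ : ℝ) (hE : 0 < E) (hr : 0 < r) (hσ : 0 < σ)
    (ϱ : ℝ → ℝ)
    (hϱ : ∀ τ : ℝ, 0 < τ →
      (2 * r / σ) * Real.sqrt (2 * Real.pi * τ) * Real.exp (r * τ) < 1 →
      ϱ τ = E * Real.exp (-(r - σ ^ 2 / 2) * τ - σ * Real.sqrt (2 * τ) *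
        Real.sqrt (-Real.log ((2 * r / σ) * Real.sqrt (2 * Real.pi * τ)
          * Real.exp (r * τ))))) :
    Filter.Tendsto (fun τ : ℝ => (E - ϱ τ) / (Real.sqrt τ * Real.sqrt (-Real.log τ)))
      (nhdsWithin 0 (Set.Ioi 0)) (nhds (E * σ)) := by
  have ha : 0 < 2 * r / σ := by positivity
  have hb : 0 < 2 * Real.pi := by positivity
  have hsmall : ∀ᶠ τ in 𝓝[>] (0 : ℝ),
      (2 * r / σ) * Real.sqrt (2 * Real.pi * τ) * Real.exp (r * τ) < 1 := by
    have hc : Continuous fun τ : ℝ =>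
        (2 * r / σ) * Real.sqrt (2 * Real.pi * τ) * Real.exp (r * τ) := by fun_prop
    exact nhdsWithin_le_nhds ((hc.tendsto 0).eventually_lt_const (by simp))
  have hg0 : ∀ᶠ τ in 𝓝[>] (0 : ℝ), Real.sqrt τ * Real.sqrt (-Real.log τ) ≠ 0 := by
    filter_upwards [Ioo_mem_nhdsGT (zero_lt_one' ℝ)] with τ hτ
    exact (mul_pos (Real.sqrt_pos.2 hτ.1)
      (Real.sqrt_pos.2 (neg_pos.2 (Real.log_neg hτ.1 hτ.2)))).ne'
  have hL : Tendsto (fun τ : ℝ => (Real.sqrt (-Real.log τ))⁻¹) (𝓝[>] 0) (𝓝 0) :=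
    (Real.tendsto_sqrt_atTop.comp
      (tendsto_neg_atBot_atTop.comp Real.tendsto_log_nhdsGT_zero)).inv_tendsto_atTop
  have hsqrt : Tendsto (fun τ : ℝ => Real.sqrt τ) (𝓝[>] 0) (𝓝 0) := by
    simpa using (Real.continuous_sqrt.tendsto 0).mono_left nhdsWithin_le_nhds
  have hX : Tendsto (fun τ : ℝ => (-(r - σ ^ 2 / 2) * τ - σ * Real.sqrt (2 * τ) *
        Real.sqrt (-Real.log ((2 * r / σ) * Real.sqrt (2 * Real.pi * τ)
          * Real.exp (r * τ)))) / (Real.sqrt τ * Real.sqrt (-Real.log τ)))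
      (𝓝[>] 0) (𝓝 (-σ)) := by
    have h := ((hsqrt.mul hL).const_mul (-(r - σ ^ 2 / 2))).sub
      ((tendsto_sqrt_neg_log_mul_sqrt_mul_exp r ha hb).const_mul (σ * Real.sqrt 2))
    have e : -(r - σ ^ 2 / 2) * (0 * 0) - σ * Real.sqrt 2 * Real.sqrt (1 / 2) = -σ := by
      rw [mul_assoc σ, ← Real.sqrt_mul zero_le_two]
      norm_num
    rw [e] at h
    refine h.congr' ?_
    filter_upwards [hg0, self_mem_nhdsWithin] with τ hg hτ
    have hs : Real.sqrt τ ≠ 0 := left_ne_zero_of_mul hg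
    have hl : Real.sqrt (-Real.log τ) ≠ 0 := right_ne_zero_of_mul hg
    have hsq : Real.sqrt τ ^ 2 = τ := Real.sq_sqrt (le_of_lt hτ)
    rw [Real.sqrt_mul zero_le_two τ, eq_div_iff hg]
    generalize Real.sqrt (-Real.log (_ * _)) = m
    field_simp
    linear_combination (-(r * 2 - σ ^ 2)) * hsq
  have h := (tendsto_one_sub_exp_div hg0 tendsto_sqrt_mul_sqrt_neg_log hX).const_mul E
  rw [neg_neg] at h
  refine h.congr' ?_
  filter_upwards [hsmall, self_mem_nhdsWithin] with τ h1 hτ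
  rw [hϱ τ hτ h1]
  ring
end
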